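/- arXiv:2311.15021 — 3 statements merged into one kernel-verified Lean document; each statement's English description precedes it below -/
import Mathlib

section
/- Let B be a Fell bundle over a groupoid H and M a right B-demi-equivalence. Then the Cauchy–Schwarz inequality holds: for m₁, m₂ in fibres of M with the same ρ-anchor, ⟨m₁,m₂⟩_B · ⟨m₁,m₂⟩_B* ≤ ‖m₂‖² · ⟨m₁,m₁⟩_B as elements of the C*-algebra B(σ(m₁)). -/
/- Statement 9: Cauchy–Schwarz for demi-equivalences: for m₁, m₂ in fibres of M with the
same ρ-anchor, ⟨m₁,m₂⟩_B · ⟨m₁,m₂⟩_B* ≤ ‖m₂‖² · ⟨m₁,m₁⟩_B in the C*-algebra B(σ(m₁)). -/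

/-- An upper semicontinuous Banach bundle over a topological space. -/
structure IsUSCBanachBundle {X : Type*} [TopologicalSpace X] (E : X → Type*)
    [∀ x, NormedAddCommGroup (E x)] [∀ x, NormedSpace ℂ (E x)] [∀ x, CompleteSpace (E x)]
    [TopologicalSpace (Σ x, E x)] : Prop where
  cont_proj : Continuous (Sigma.fst : (Σ x, E x) → X)
  open_proj : IsOpenMap (Sigma.fst : (Σ x, E x) → X)
  usc_norm : UpperSemicontinuous (fun m : Σ x, E x => ‖m.2‖)
  cont_add : Continuous (fun p : {q : (Σ x, E x) × (Σ x, E x) // q.1.1 = q.2.1} =>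
    (⟨p.1.1.1, p.1.1.2 + cast (congrArg E p.2).symm p.1.2.2⟩ : Σ x, E x))
  cont_smul : Continuous (fun p : ℂ × (Σ x, E x) => (⟨p.2.1, p.1 • p.2.2⟩ : Σ x, E x))
  zero_criterion : ∀ (F : Filter (Σ x, E x)) (x : X),
    Filter.Tendsto (fun m : Σ x, E x => ‖m.2‖) F (nhds 0) →
      Filter.Tendsto Sigma.fst F (nhds x) → F ≤ nhds (⟨x, 0⟩ : Σ x, E x)

/-- A topological groupoid: a topological space `G` with source and range maps (valued in the
units, viewed inside `G`), a partially defined multiplication, and inversion, all continuous. -/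
structure TopGroupoid (G : Type*) [TopologicalSpace G] : Type _ where
  src : G → G
  rng : G → G
  mul : (g h : G) → src g = rng h → G
  inv : G → G
  rng_src : ∀ g, rng (src g) = src g
  src_src : ∀ g, src (src g) = src g
  src_rng : ∀ g, src (rng g) = rng g
  rng_rng : ∀ g, rng (rng g) = rng g
  src_mul : ∀ g h hgh, src (mul g h hgh) = src h
  rng_mul : ∀ g h hgh, rng (mul g h hgh) = rng g
  mul_assoc : ∀ g h k (hgh : src g = rng h) (hhk : src h = rng k)
    (h₁ : src (mul g h hgh) = rng k) (h₂ : src g = rng (mul h k hhk)),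
    mul (mul g h hgh) k h₁ = mul g (mul h k hhk) h₂
  src_inv : ∀ g, src (inv g) = rng g
  rng_inv : ∀ g, rng (inv g) = src g
  mul_inv : ∀ g (h : src g = rng (inv g)), mul g (inv g) h = rng g
  inv_mul : ∀ g (h : src (inv g) = rng g), mul (inv g) g h = src g
  mul_src : ∀ g (h : src g = rng (src g)), mul g (src g) h = g
  rng_mul' : ∀ g (h : src (rng g) = rng g), mul (rng g) g h = g
  continuous_src : Continuous src
  continuous_rng : Continuous rng
  continuous_inv : Continuous inv
  continuous_mul : Continuous (fun p : {p : G × G // src p.1 = rng p.2} =>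
    mul p.1.1 p.1.2 p.2)

namespace TopGroupoid

variable {G : Type*} [TopologicalSpace G] (𝒢 : TopGroupoid G)

/-- The unit space of the groupoid, viewed as a subset of `G`. -/
def units : Set G := Set.range 𝒢.rng

/-- The source map is open (onto the unit space, with its subspace topology). -/
def OpenSource : Prop :=
  ∀ U : Set G, IsOpen U → ∃ V : Set G, IsOpen V ∧ 𝒢.src '' U = V ∩ 𝒢.units

end TopGroupoid

/-- A continuous right action of a topological groupoid `H` on a topological space `X`,
along an anchor map `σ : X → H` (valued in the units of `H`). -/
structure RightGroupoidAction {H : Type*} [TopologicalSpace H] (𝒢 : TopGroupoid H)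
    (X : Type*) [TopologicalSpace X] : Type _ where
  anchor : X → H
  anchor_unit : ∀ x, 𝒢.rng (anchor x) = anchor x
  continuous_anchor : Continuous anchor
  act : (x : X) → (h : H) → anchor x = 𝒢.rng h → X
  anchor_act : ∀ x h hc, anchor (act x h hc) = 𝒢.src h
  act_unit : ∀ x (hc : anchor x = 𝒢.rng (anchor x)), act x (anchor x) hc = x
  act_mul : ∀ x h h' (hc : anchor x = 𝒢.rng h) (hc' : anchor (act x h hc) = 𝒢.rng h')
    (hhh : 𝒢.src h = 𝒢.rng h') (hc'' : anchor x = 𝒢.rng (𝒢.mul h h' hhh)),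
    act (act x h hc) h' hc' = act x (𝒢.mul h h' hhh) hc''
  continuous_act : Continuous (fun p : {p : X × H // anchor p.1 = 𝒢.rng p.2} =>
    act p.1.1 p.1.2 p.2)

namespace RightGroupoidAction

variable {H : Type*} [TopologicalSpace H] {𝒢 : TopGroupoid H}
  {X : Type*} [TopologicalSpace X] (ρ : RightGroupoidAction 𝒢 X)

/-- The action is free: only units act trivially. -/
def IsFree : Prop := ∀ x h hc, ρ.act x h hc = x → h = ρ.anchor x

/-- The action is proper: `(x, h) ↦ (x, x·h)` is a proper map. -/
def IsProper : Prop :=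
  IsProperMap (fun p : {p : X × H // ρ.anchor p.1 = 𝒢.rng p.2} =>
    ((p.1.1, ρ.act p.1.1 p.1.2 p.2) : X × X))

/-- The anchor map is open onto the unit space. -/
def OpenAnchor : Prop :=
  ∀ U : Set X, IsOpen U → ∃ V : Set H, IsOpen V ∧ ρ.anchor '' U = V ∩ 𝒢.units

/-- The anchor map is surjective onto the unit space. -/
def SurjAnchor : Prop := ∀ u ∈ 𝒢.units, ∃ x, ρ.anchor x = u

/-- `X` is a principal (free and proper) right `H`-space. -/
def IsPrincipal : Prop := ρ.IsFree ∧ ρ.IsProper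

/-- Two points of the fibred product `X ×_{σ,σ} X` are equivalent when they differ by the
diagonal action of `H`. -/
def diagRel (p q : {p : X × X // ρ.anchor p.1 = ρ.anchor p.2}) : Prop :=
  ∃ (h : H) (hc₁ : ρ.anchor p.1.1 = 𝒢.rng h) (hc₂ : ρ.anchor p.1.2 = 𝒢.rng h),
    q.1.1 = ρ.act p.1.1 h hc₁ ∧ q.1.2 = ρ.act p.1.2 h hc₂

end RightGroupoidAction

/-- A continuous left action of a topological groupoid. -/
structure LeftGroupoidAction {G : Type*} [TopologicalSpace G] (𝒢 : TopGroupoid G)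
    (X : Type*) [TopologicalSpace X] : Type _ where
  anchor : X → G
  anchor_unit : ∀ x, 𝒢.rng (anchor x) = anchor x
  continuous_anchor : Continuous anchor
  act : (g : G) → (x : X) → 𝒢.src g = anchor x → X
  anchor_act : ∀ g x hc, anchor (act g x hc) = 𝒢.rng g
  act_unit : ∀ x (hc : 𝒢.src (anchor x) = anchor x), act (anchor x) x hc = x
  act_mul : ∀ g g' x (hc : 𝒢.src g' = anchor x) (hc' : 𝒢.src g = anchor (act g' x hc))
    (hgg : 𝒢.src g = 𝒢.rng g') (hc'' : 𝒢.src (𝒢.mul g g' hgg) = anchor x),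
    act g (act g' x hc) hc' = act (𝒢.mul g g' hgg) x hc''
  continuous_act : Continuous (fun p : {p : G × X // 𝒢.src p.1 = anchor p.2} =>
    act p.1.1 p.1.2 p.2)

namespace LeftGroupoidAction

variable {G : Type*} [TopologicalSpace G] {𝒢 : TopGroupoid G}
  {X : Type*} [TopologicalSpace X] (lam : LeftGroupoidAction 𝒢 X)

def IsFree : Prop := ∀ g x hc, lam.act g x hc = x → g = lam.anchor x

def IsProper : Prop :=
  IsProperMap (fun p : {p : G × X // 𝒢.src p.1 = lam.anchor p.2} =>
    ((lam.act p.1.1 p.1.2 p.2, p.1.2) : X × X))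

def OpenAnchor : Prop :=
  ∀ U : Set X, IsOpen U → ∃ V : Set G, IsOpen V ∧ lam.anchor '' U = V ∩ 𝒢.units

def SurjAnchor : Prop := ∀ u ∈ 𝒢.units, ∃ x, lam.anchor x = u

def IsPrincipal : Prop := lam.IsFree ∧ lam.IsProper

end LeftGroupoidAction

/-- A `(G, H)`-groupoid equivalence: commuting principal left `G`- and right `H`-actions on
`X` whose anchor maps are open surjections onto the unit spaces and identify `X/H` with `G⁰`
and `G\X` with `H⁰` (encoded: the fibres of each anchor map are exactly the orbits of the
other action). -/
structure GroupoidEquivalence {G H : Type*} [TopologicalSpace G] [TopologicalSpace H]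
    (𝒢 : TopGroupoid G) (ℋ : TopGroupoid H) (X : Type*) [TopologicalSpace X] : Type _ where
  lact : LeftGroupoidAction 𝒢 X
  ract : RightGroupoidAction ℋ X
  commute : ∀ g x h (hcl : 𝒢.src g = lact.anchor x) (hcr : ract.anchor x = ℋ.rng h)
    (hcr' : ract.anchor (lact.act g x hcl) = ℋ.rng h)
    (hcl' : 𝒢.src g = lact.anchor (ract.act x h hcr)),
    ract.act (lact.act g x hcl) h hcr' = lact.act g (ract.act x h hcr) hcl'
  lact_principal : lact.IsPrincipal
  ract_principal : ract.IsPrincipal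
  lact_openAnchor : lact.OpenAnchor
  ract_openAnchor : ract.OpenAnchor
  lact_surjAnchor : lact.SurjAnchor
  ract_surjAnchor : ract.SurjAnchor
  /-- the right anchor `σ` is invariant under the left action and its fibres are the
  `G`-orbits -/
  ract_anchor_lact : ∀ g x hc, ract.anchor (lact.act g x hc) = ract.anchor x
  ract_anchor_eq_iff : ∀ x y, ract.anchor x = ract.anchor y ↔
    ∃ g hc, lact.act g y hc = x
  /-- the left anchor `ρ` is invariant under the right action and its fibres are the
  `H`-orbits -/
  lact_anchor_ract : ∀ x h hc, lact.anchor (ract.act x h hc) = lact.anchor x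
  lact_anchor_eq_iff : ∀ x y, lact.anchor x = lact.anchor y ↔
    ∃ h hc, ract.act y h hc = x

/-- A (saturated) Fell bundle over the topological groupoid `𝒢`: an upper semicontinuous
Banach bundle `Bf` over `H` with a continuous fibred multiplication and involution
satisfying the Fell bundle axioms, whose fibres over units are C*-algebras and whose fibres
are full (imprimitivity) bimodules. -/
structure FellBundle {H : Type*} [TopologicalSpace H] (𝒢 : TopGroupoid H)
    (Bf : H → Type*) [∀ g, NormedAddCommGroup (Bf g)] [∀ g, NormedSpace ℂ (Bf g)]
    [∀ g, CompleteSpace (Bf g)] [TopologicalSpace (Σ g, Bf g)] : Type _ where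
  bundle : IsUSCBanachBundle Bf
  mul : ∀ {g h : H} (hc : 𝒢.src g = 𝒢.rng h), Bf g → Bf h → Bf (𝒢.mul g h hc)
  star' : ∀ {g : H}, Bf g → Bf (𝒢.inv g)
  mul_add : ∀ {g h} (hc : 𝒢.src g = 𝒢.rng h) (a : Bf g) (b b' : Bf h),
    mul hc a (b + b') = mul hc a b + mul hc a b'
  add_mul : ∀ {g h} (hc : 𝒢.src g = 𝒢.rng h) (a a' : Bf g) (b : Bf h),
    mul hc (a + a') b = mul hc a b + mul hc a' b
  mul_smul : ∀ {g h} (hc : 𝒢.src g = 𝒢.rng h) (c : ℂ) (a : Bf g) (b : Bf h),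
    mul hc (c • a) b = c • mul hc a b
  mul_smul' : ∀ {g h} (hc : 𝒢.src g = 𝒢.rng h) (c : ℂ) (a : Bf g) (b : Bf h),
    mul hc a (c • b) = c • mul hc a b
  norm_mul_le : ∀ {g h} (hc : 𝒢.src g = 𝒢.rng h) (a : Bf g) (b : Bf h),
    ‖mul hc a b‖ ≤ ‖a‖ * ‖b‖
  mul_assoc : ∀ {g h k} (hgh : 𝒢.src g = 𝒢.rng h) (hhk : 𝒢.src h = 𝒢.rng k)
    (h₁ : 𝒢.src (𝒢.mul g h hgh) = 𝒢.rng k) (h₂ : 𝒢.src g = 𝒢.rng (𝒢.mul h k hhk))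
    (a : Bf g) (b : Bf h) (c : Bf k),
    HEq (mul h₁ (mul hgh a b) c) (mul h₂ a (mul hhk b c))
  star_add : ∀ {g} (a b : Bf g), star' (a + b) = star' a + star' b
  star_smul : ∀ {g} (c : ℂ) (a : Bf g), star' (c • a) = (starRingEnd ℂ c) • star' a
  star_star : ∀ {g} (a : Bf g), HEq (star' (star' a)) a
  norm_star : ∀ {g} (a : Bf g), ‖star' a‖ = ‖a‖
  star_mul : ∀ {g h} (hc : 𝒢.src g = 𝒢.rng h)
    (hc' : 𝒢.src (𝒢.inv h) = 𝒢.rng (𝒢.inv g)) (a : Bf g) (b : Bf h),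
    HEq (star' (mul hc a b)) (mul hc' (star' b) (star' a))
  cstar_norm : ∀ {g} (hc : 𝒢.src (𝒢.inv g) = 𝒢.rng g) (a : Bf g),
    ‖mul hc (star' a) a‖ = ‖a‖ ^ 2
  continuous_star : Continuous (fun m : Σ g, Bf g =>
    (⟨𝒢.inv m.1, star' m.2⟩ : Σ g, Bf g))
  continuous_mul : Continuous
    (fun p : {p : (Σ g, Bf g) × (Σ g, Bf g) // 𝒢.src p.1.1 = 𝒢.rng p.2.1} =>
      (⟨𝒢.mul p.1.1.1 p.1.2.1 p.2, mul p.2 p.1.1.2 p.1.2.2⟩ : Σ g, Bf g))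
  saturated : ∀ {g h} (hc : 𝒢.src g = 𝒢.rng h),
    Dense ((Submodule.span ℂ {c : Bf (𝒢.mul g h hc) | ∃ a b, c = mul hc a b} :
      Submodule ℂ (Bf (𝒢.mul g h hc))) : Set (Bf (𝒢.mul g h hc)))

namespace FellBundle

variable {H : Type*} [TopologicalSpace H] {𝒢 : TopGroupoid H}
  {Bf : H → Type*} [∀ g, NormedAddCommGroup (Bf g)] [∀ g, NormedSpace ℂ (Bf g)]
  [∀ g, CompleteSpace (Bf g)] [TopologicalSpace (Σ g, Bf g)]

/-- Positivity in the unit-fibre C*-algebra `Bf u`: an element is nonnegative iff it is of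
the form `a* a`. -/
def nonneg (FB : FellBundle 𝒢 Bf) {u : H} (_ : 𝒢.rng u = u) (b : Bf u) : Prop :=
  ∃ a : Bf u, HEq (FB.mul (𝒢.src_inv u) (FB.star' a) a) b

/-- The order on the unit-fibre C*-algebra `Bf u`. -/
def le (FB : FellBundle 𝒢 Bf) {u : H} (hu : 𝒢.rng u = u) (a b : Bf u) : Prop :=
  FB.nonneg hu (b - a)

/-- The multiplication of the unit-fibre C*-algebra `Bf u` (the Fell bundle multiplication,
recast to land in `Bf u`). -/
def unitMul (FB : FellBundle 𝒢 Bf) {u : H} (hu : 𝒢.rng u = u)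
    (hmul : 𝒢.mul u u ((congrArg 𝒢.src hu.symm).trans (𝒢.src_rng u)) = u)
    (a b : Bf u) : Bf u :=
  cast (congrArg Bf hmul) (FB.mul ((congrArg 𝒢.src hu.symm).trans (𝒢.src_rng u)) a b)

end FellBundle

/-- A right `B`-demi-equivalence over a (principal) right `H`-space `X` (Definition 2.1):
an upper semicontinuous Banach bundle `Mf` over `X` with a right `B`-action covering the
`H`-action on `X` and a continuous `B`-valued inner product satisfying (DE1)–(DE8). -/
structure DemiEquiv {H : Type*} [TopologicalSpace H] {𝒢 : TopGroupoid H}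
    {Bf : H → Type*} [∀ g, NormedAddCommGroup (Bf g)] [∀ g, NormedSpace ℂ (Bf g)]
    [∀ g, CompleteSpace (Bf g)] [TopologicalSpace (Σ g, Bf g)]
    (FB : FellBundle 𝒢 Bf)
    {X : Type*} [TopologicalSpace X] (ra : RightGroupoidAction 𝒢 X)
    (Mf : X → Type*) [∀ x, NormedAddCommGroup (Mf x)] [∀ x, NormedSpace ℂ (Mf x)]
    [∀ x, CompleteSpace (Mf x)] [TopologicalSpace (Σ x, Mf x)] : Type _ where
  bundle : IsUSCBanachBundle Mf
  /-- (DE1) the right action, covering the `H`-action on `X` -/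
  ract : ∀ (x : X) (h : H) (hc : ra.anchor x = 𝒢.rng h), Mf x → Bf h → Mf (ra.act x h hc)
  /-- (DE2) the `B`-valued inner product, covering the map `(x, x·h) ↦ h` -/
  inner : ∀ (x : X) (h : H) (hc : ra.anchor x = 𝒢.rng h),
    Mf x → Mf (ra.act x h hc) → Bf h
  /-- (DE3) sesquilinearity -/
  inner_add_left : ∀ x h hc (m m' : Mf x) n,
    inner x h hc (m + m') n = inner x h hc m n + inner x h hc m' n
  inner_smul_left : ∀ x h hc (c : ℂ) (m : Mf x) n,
    inner x h hc (c • m) n = (starRingEnd ℂ c) • inner x h hc m n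
  inner_add_right : ∀ x h hc (m : Mf x) n n',
    inner x h hc m (n + n') = inner x h hc m n + inner x h hc m n'
  inner_smul_right : ∀ x h hc (c : ℂ) (m : Mf x) n,
    inner x h hc m (c • n) = c • inner x h hc m n
  /-- (DE3) continuity of the inner product -/
  inner_continuous : Continuous
    (fun q : {q : (Σ x, Mf x) × H × (Σ x, Mf x) //
        ∃ hc : ra.anchor q.1.1 = 𝒢.rng q.2.1, q.2.2.1 = ra.act q.1.1 q.2.1 hc} =>
      (⟨q.1.2.1, inner q.1.1.1 q.1.2.1 q.2.choose q.1.1.2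
        (cast (congrArg Mf q.2.choose_spec) q.1.2.2.2)⟩ : Σ g, Bf g))
  /-- (DE4) `⟨m₁, m₂ ⊳ b⟩ = ⟨m₁, m₂⟩ b` -/
  inner_ract : ∀ (x : X) (h k : H) (hc : ra.anchor x = 𝒢.rng h)
    (hck : 𝒢.src h = 𝒢.rng k) (hc₂ : ra.anchor (ra.act x h hc) = 𝒢.rng k)
    (hcmul : ra.anchor x = 𝒢.rng (𝒢.mul h k hck))
    (hacts : ra.act (ra.act x h hc) k hc₂ = ra.act x (𝒢.mul h k hck) hcmul)
    (m₁ : Mf x) (m₂ : Mf (ra.act x h hc)) (b : Bf k),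
    inner x (𝒢.mul h k hck) hcmul m₁
        (cast (congrArg Mf hacts) (ract (ra.act x h hc) k hc₂ m₂ b))
      = FB.mul hck (inner x h hc m₁ m₂) b
  /-- (DE5) `⟨m₁, m₂⟩* = ⟨m₂, m₁⟩` -/
  inner_star : ∀ (x : X) (h : H) (hc : ra.anchor x = 𝒢.rng h)
    (hc' : ra.anchor (ra.act x h hc) = 𝒢.rng (𝒢.inv h))
    (hback : ra.act (ra.act x h hc) (𝒢.inv h) hc' = x)
    (m : Mf x) (n : Mf (ra.act x h hc)),
    FB.star' (inner x h hc m n)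
      = inner (ra.act x h hc) (𝒢.inv h) hc' n (cast (congrArg Mf hback.symm) m)
  /-- (DE6) positivity -/
  inner_self_nonneg : ∀ (x : X) (hc : ra.anchor x = 𝒢.rng (ra.anchor x)) (m : Mf x),
    FB.nonneg (ra.anchor_unit x)
      (inner x (ra.anchor x) hc m (cast (congrArg Mf (ra.act_unit x hc).symm) m))
  /-- (DE6) definiteness -/
  inner_self_eq_zero : ∀ (x : X) (hc : ra.anchor x = 𝒢.rng (ra.anchor x)) (m : Mf x),
    inner x (ra.anchor x) hc m (cast (congrArg Mf (ra.act_unit x hc).symm) m) = 0 → m = 0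
  /-- (DE7) compatibility of the norms -/
  norm_eq : ∀ (x : X) (hc : ra.anchor x = 𝒢.rng (ra.anchor x)) (m : Mf x),
    ‖m‖ = Real.sqrt
      ‖inner x (ra.anchor x) hc m (cast (congrArg Mf (ra.act_unit x hc).symm) m)‖
  /-- (DE8) fibrewise fullness -/
  full : ∀ (x : X) (hc : ra.anchor x = 𝒢.rng (ra.anchor x)),
    Dense ((Submodule.span ℂ {b : Bf (ra.anchor x) | ∃ m n : Mf x,
      b = inner x (ra.anchor x) hc m (cast (congrArg Mf (ra.act_unit x hc).symm) n)} :
        Submodule ℂ (Bf (ra.anchor x))) : Set (Bf (ra.anchor x)))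

open scoped ComplexOrder

/-- The C*-algebraic core of the argument. -/
theorem cs_core {A : Type*} [NonUnitalCStarAlgebra A] [PartialOrder A] [StarOrderedRing A]
    (q : A) (hq : 0 ≤ q) (s : ℝ) (hs : 0 < s) (hqs : ‖q‖ ≤ s) :
    ∃ (l : ℝ) (a : A), IsSelfAdjoint a ∧
      l ^ 2 • q + l • (q * a + a * q) + a * q * a
        = (s⁻¹) • q - ((1 / (2 * s)) ^ 2 * s⁻¹) • (s ^ 2 • q + (2 * s) • (q * q) + q * q * q) := by
  have hqsa : IsSelfAdjoint q := IsSelfAdjoint.of_nonneg hq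
  let F : ℝ → ℝ := fun t => Real.sqrt (s⁻¹ - (1 / (2 * s)) ^ 2 * s⁻¹ * (s + t) ^ 2)
  let g : ℝ → ℝ := fun t => F t - F 0
  have hg0 : g 0 = 0 := by simp [g]
  have hgc : Continuous g := by fun_prop
  refine ⟨F 0, cfcₙ g q, cfcₙ_predicate g q, ?_⟩
  have hqid : cfcₙ (fun t : ℝ => t) q = q := cfcₙ_id' ℝ q
  have hmul : ∀ f f' : ℝ → ℝ, Continuous f → Continuous f' → f 0 = 0 → f' 0 = 0 →
      cfcₙ f q * cfcₙ f' q = cfcₙ (fun t => f t * f' t) q := fun f f' h h' h0 h0' =>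
    (cfcₙ_mul f f' q h.continuousOn h0 h'.continuousOn h0').symm
  have hadd : ∀ f f' : ℝ → ℝ, Continuous f → Continuous f' → f 0 = 0 → f' 0 = 0 →
      cfcₙ f q + cfcₙ f' q = cfcₙ (fun t => f t + f' t) q := fun f f' h h' h0 h0' =>
    (cfcₙ_add (a := q) f f' h.continuousOn h0 h'.continuousOn h0').symm
  have hsub : ∀ f f' : ℝ → ℝ, Continuous f → Continuous f' → f 0 = 0 → f' 0 = 0 →
      cfcₙ f q - cfcₙ f' q = cfcₙ (fun t => f t - f' t) q := fun f f' h h' h0 h0' =>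
    (cfcₙ_sub f f' q h.continuousOn h0 h'.continuousOn h0').symm
  have hsm : ∀ (c : ℝ) (f : ℝ → ℝ), Continuous f → f 0 = 0 →
      c • cfcₙ f q = cfcₙ (fun t => c • f t) q := fun c f h h0 =>
    (cfcₙ_smul c f q h.continuousOn h0).symm
  have key : (F 0) ^ 2 • cfcₙ (fun t : ℝ => t) q
      + (F 0) • (cfcₙ (fun t : ℝ => t) q * cfcₙ g q + cfcₙ g q * cfcₙ (fun t : ℝ => t) q)
      + cfcₙ g q * cfcₙ (fun t : ℝ => t) q * cfcₙ g q
      = (s⁻¹) • cfcₙ (fun t : ℝ => t) q - ((1 / (2 * s)) ^ 2 * s⁻¹) •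
        (s ^ 2 • cfcₙ (fun t : ℝ => t) q
          + (2 * s) • (cfcₙ (fun t : ℝ => t) q * cfcₙ (fun t : ℝ => t) q)
          + cfcₙ (fun t : ℝ => t) q * cfcₙ (fun t : ℝ => t) q * cfcₙ (fun t : ℝ => t) q) := by
    repeat first
      | rw [hmul _ _ (by fun_prop) (by fun_prop) (by simp [hg0]) (by simp [hg0])]
      | rw [hsm _ _ (by fun_prop) (by simp [hg0])]
      | rw [hadd _ _ (by fun_prop) (by fun_prop) (by simp [hg0]) (by simp [hg0])]
      | rw [hsub _ _ (by fun_prop) (by fun_prop) (by simp [hg0]) (by simp [hg0])]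
    apply cfcₙ_congr
    intro t ht
    have ht0 : 0 ≤ t := quasispectrum_nonneg_of_nonneg q hq t ht
    have hts : t ≤ s := by
      have := NonUnitalIsometricContinuousFunctionalCalculus.norm_quasispectrum_le (𝕜 := ℝ) q ht
      exact (le_abs_self t).trans (this.trans hqs)
    have hF : F t ^ 2 = s⁻¹ - (1 / (2 * s)) ^ 2 * s⁻¹ * (s + t) ^ 2 := by
      apply Real.sq_sqrt
      have : (s⁻¹ - (1 / (2 * s)) ^ 2 * s⁻¹ * (s + t) ^ 2)
        = s⁻¹ * (1 / (2 * s)) ^ 2 * ((s - t) * (3 * s + t)) := by field_simp; ring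
      rw [this]
      have : 0 ≤ s - t := by linarith
      positivity
    simp only [smul_eq_mul, g]
    linear_combination t * hF
  rwa [hqid] at key

namespace TopGroupoid
variable {G : Type*} [TopologicalSpace G] (𝒢 : TopGroupoid G)

theorem src_of_unit {u : G} (hu : 𝒢.rng u = u) : 𝒢.src u = u := by
  have := 𝒢.src_rng u
  rwa [hu] at this

theorem mul_left_unit {u g : G} (hg : 𝒢.rng g = u) (hc : 𝒢.src u = 𝒢.rng g) :
    𝒢.mul u g hc = g := by
  subst hg; exact 𝒢.rng_mul' g hc

theorem mul_right_unit {u g : G} (hg : 𝒢.src g = u) (hc : 𝒢.src g = 𝒢.rng u) :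
    𝒢.mul g u hc = g := by
  subst hg; exact 𝒢.mul_src g hc

theorem inv_of_unit {u : G} (hu : 𝒢.rng u = u) : 𝒢.inv u = u := by
  have hs := 𝒢.src_of_unit hu
  have hr : 𝒢.rng (𝒢.inv u) = u := (𝒢.rng_inv u).trans hs
  rw [← 𝒢.mul_left_unit hr (hs.trans hr.symm), 𝒢.mul_inv, hu]

theorem inv_inv_aux (g : G) : 𝒢.inv (𝒢.inv g) = g := by
  have e1 : 𝒢.src (𝒢.inv (𝒢.inv g)) = 𝒢.rng (𝒢.inv g) := 𝒢.src_inv _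
  have e2 : 𝒢.src (𝒢.inv g) = 𝒢.rng g := 𝒢.src_inv _
  have e3 := 𝒢.mul_assoc (𝒢.inv (𝒢.inv g)) (𝒢.inv g) g e1 e2
    (by rw [𝒢.src_mul]; exact e2) (by rw [𝒢.rng_mul]; exact e1)
  have e4 : 𝒢.mul (𝒢.inv (𝒢.inv g)) (𝒢.inv g) e1 = 𝒢.rng g := by
    rw [𝒢.inv_mul, 𝒢.src_inv]
  have e5 : 𝒢.mul (𝒢.inv g) g e2 = 𝒢.src g := 𝒢.inv_mul g e2
  simp only [e4, e5] at e3
  rw [𝒢.mul_left_unit rfl, 𝒢.mul_right_unit] at e3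
  · exact e3.symm
  · rw [e1, 𝒢.rng_inv]

end TopGroupoid

namespace FellBundle

variable {H : Type*} [TopologicalSpace H] {𝒢 : TopGroupoid H}
  {Bf : H → Type*} [∀ g, NormedAddCommGroup (Bf g)] [∀ g, NormedSpace ℂ (Bf g)]
  [∀ g, CompleteSpace (Bf g)] [TopologicalSpace (Σ g, Bf g)] (FB : FellBundle 𝒢 Bf)

/-- multiplication with a transported target fibre -/
def mulT {g h k : H} (hc : 𝒢.src g = 𝒢.rng h) (e : 𝒢.mul g h hc = k) (a : Bf g) (b : Bf h) :
    Bf k := cast (congrArg Bf e) (FB.mul hc a b)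

/-- involution with a transported target fibre -/
def starT {g k : H} (e : 𝒢.inv g = k) (a : Bf g) : Bf k := cast (congrArg Bf e) (FB.star' a)

variable {g h k l gh hk : H}

theorem mulT_add (hc : 𝒢.src g = 𝒢.rng h) (e : 𝒢.mul g h hc = k) (a : Bf g) (b b' : Bf h) :
    FB.mulT hc e a (b + b') = FB.mulT hc e a b + FB.mulT hc e a b' := by
  subst e; exact FB.mul_add hc a b b'

theorem add_mulT (hc : 𝒢.src g = 𝒢.rng h) (e : 𝒢.mul g h hc = k) (a a' : Bf g) (b : Bf h) :
    FB.mulT hc e (a + a') b = FB.mulT hc e a b + FB.mulT hc e a' b := by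
  subst e; exact FB.add_mul hc a a' b

theorem smul_mulT (hc : 𝒢.src g = 𝒢.rng h) (e : 𝒢.mul g h hc = k) (c : ℂ) (a : Bf g) (b : Bf h) :
    FB.mulT hc e (c • a) b = c • FB.mulT hc e a b := by
  subst e; exact FB.mul_smul hc c a b

theorem mulT_smul (hc : 𝒢.src g = 𝒢.rng h) (e : 𝒢.mul g h hc = k) (c : ℂ) (a : Bf g) (b : Bf h) :
    FB.mulT hc e a (c • b) = c • FB.mulT hc e a b := by
  subst e; exact FB.mul_smul' hc c a b

theorem mulT_zero (hc : 𝒢.src g = 𝒢.rng h) (e : 𝒢.mul g h hc = k) (a : Bf g) :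
    FB.mulT hc e a 0 = 0 := by
  have := FB.mulT_smul hc e 0 a 0
  simpa using this

theorem zero_mulT (hc : 𝒢.src g = 𝒢.rng h) (e : 𝒢.mul g h hc = k) (b : Bf h) :
    FB.mulT hc e 0 b = 0 := by
  have := FB.smul_mulT hc e 0 0 b
  simpa using this

theorem norm_mulT_le (hc : 𝒢.src g = 𝒢.rng h) (e : 𝒢.mul g h hc = k) (a : Bf g) (b : Bf h) :
    ‖FB.mulT hc e a b‖ ≤ ‖a‖ * ‖b‖ := by
  subst e; exact FB.norm_mul_le hc a b

theorem mulT_assoc (hgh : 𝒢.src g = 𝒢.rng h) (hhk : 𝒢.src h = 𝒢.rng k)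
    (e1 : 𝒢.mul g h hgh = gh) (e2 : 𝒢.mul h k hhk = hk)
    (h1 : 𝒢.src gh = 𝒢.rng k) (h2 : 𝒢.src g = 𝒢.rng hk)
    (e3 : 𝒢.mul gh k h1 = l) (e4 : 𝒢.mul g hk h2 = l) (a : Bf g) (b : Bf h) (c : Bf k) :
    FB.mulT h1 e3 (FB.mulT hgh e1 a b) c = FB.mulT h2 e4 a (FB.mulT hhk e2 b c) := by
  subst e1 e2 e3
  apply eq_of_heq
  exact (FB.mul_assoc hgh hhk h1 h2 a b c).trans (cast_heq _ _).symm

theorem starT_add (e : 𝒢.inv g = k) (a b : Bf g) :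
    FB.starT e (a + b) = FB.starT e a + FB.starT e b := by
  subst e; exact FB.star_add a b

theorem starT_smul (e : 𝒢.inv g = k) (c : ℂ) (a : Bf g) :
    FB.starT e (c • a) = (starRingEnd ℂ c) • FB.starT e a := by
  subst e; exact FB.star_smul c a

theorem norm_starT (e : 𝒢.inv g = k) (a : Bf g) : ‖FB.starT e a‖ = ‖a‖ := by
  subst e; exact FB.norm_star a

theorem starT_starT (e : 𝒢.inv g = k) (e' : 𝒢.inv k = g) (a : Bf g) :
    FB.starT e' (FB.starT e a) = a := by
  subst e
  exact eq_of_heq ((cast_heq _ _).trans (FB.star_star a))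

theorem starT_mulT {g' h' k' : H} (hc : 𝒢.src g = 𝒢.rng h) (e : 𝒢.mul g h hc = k)
    (eg : 𝒢.inv g = g') (eh : 𝒢.inv h = h') (ek : 𝒢.inv k = k')
    (hc' : 𝒢.src h' = 𝒢.rng g') (e' : 𝒢.mul h' g' hc' = k') (a : Bf g) (b : Bf h) :
    FB.starT ek (FB.mulT hc e a b) = FB.mulT hc' e' (FB.starT eh b) (FB.starT eg a) := by
  subst e eg eh ek
  apply eq_of_heq
  exact (FB.star_mul hc hc' a b).trans (cast_heq _ _).symm

theorem cstar_normT (eg : 𝒢.inv g = h) (hc : 𝒢.src h = 𝒢.rng g) (e : 𝒢.mul h g hc = k)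
    (a : Bf g) : ‖FB.mulT hc e (FB.starT eg a) a‖ = ‖a‖ ^ 2 := by
  subst eg e; exact FB.cstar_norm hc a

/-- The unit fibre as a C*-algebra. -/
@[reducible] noncomputable def fibAlg {u : H} (hu : 𝒢.rng u = u) : NonUnitalCStarAlgebra (Bf u) :=
  have hc : 𝒢.src u = 𝒢.rng u := (𝒢.src_of_unit hu).trans hu.symm
  have hm : 𝒢.mul u u hc = u := 𝒢.mul_left_unit hu hc
  have hi : 𝒢.inv u = u := 𝒢.inv_of_unit hu
  { (inferInstance : NormedAddCommGroup (Bf u)), (inferInstance : NormedSpace ℂ (Bf u)),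
    (inferInstance : CompleteSpace (Bf u)) with
    mul := FB.mulT hc hm
    left_distrib := FB.mulT_add hc hm
    right_distrib := FB.add_mulT hc hm
    zero_mul := FB.zero_mulT hc hm
    mul_zero := FB.mulT_zero hc hm
    mul_assoc := FB.mulT_assoc hc hc hm hm hc hc hm hm
    norm_mul_le := FB.norm_mulT_le hc hm
    star := FB.starT hi
    star_involutive := FB.starT_starT hi hi
    star_mul := FB.starT_mulT hc hm hi hi hi hc hm
    star_add := FB.starT_add hi
    norm_mul_self_le := fun a => by
      have := FB.cstar_normT hi hc hm a
      rw [← sq]; exact this.ge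
    smul_assoc := FB.smul_mulT hc hm
    smul_comm := fun c a b => (FB.mulT_smul hc hm c a b).symm
    star_smul := FB.starT_smul hi }

theorem fibAlg_mul {u : H} (hu : 𝒢.rng u = u) (hc : 𝒢.src u = 𝒢.rng u) (hm : 𝒢.mul u u hc = u)
    (a b : Bf u) : (FB.fibAlg hu).toMul.mul a b = FB.mulT hc hm a b := rfl

theorem nonneg_iff {u : H} (hu : 𝒢.rng u = u) (b : Bf u) :
    FB.nonneg hu b ↔ ∃ a, letI := FB.fibAlg hu; star a * a = b := by
  have hc : 𝒢.src u = 𝒢.rng u := (𝒢.src_of_unit hu).trans hu.symm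
  have hm : 𝒢.mul u u hc = u := 𝒢.mul_left_unit hu hc
  have hi : 𝒢.inv u = u := 𝒢.inv_of_unit hu
  have key : ∀ (v : H) (hv : 𝒢.inv u = v) (hc' : 𝒢.src v = 𝒢.rng u) (hm' : 𝒢.mul v u hc' = u)
      (a : Bf u), HEq (FB.mul (𝒢.src_inv u) (FB.star' a) a) (FB.mulT hc' hm' (FB.starT hv a) a) := by
    intro v hv hc' hm' a
    subst hv
    exact (cast_heq _ _).symm
  refine exists_congr fun a => ?_
  have := key u hi hc hm a
  constructor
  · intro h'
    exact eq_of_heq (this.symm.trans h')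
  · intro h'
    exact this.trans (heq_of_eq h')

theorem nonneg_add {u : H} (hu : 𝒢.rng u = u) {a b : Bf u} (ha : FB.nonneg hu a)
    (hb : FB.nonneg hu b) : FB.nonneg hu (a + b) := by
  rw [nonneg_iff] at *
  letI := FB.fibAlg hu
  let _ := CStarAlgebra.spectralOrder (Bf u)
  have _ := CStarAlgebra.spectralOrderedRing (Bf u)
  obtain ⟨a', ha⟩ := ha
  obtain ⟨b', hb⟩ := hb
  have h1 : 0 ≤ a := ha ▸ star_mul_self_nonneg a'
  have h2 : 0 ≤ b := hb ▸ star_mul_self_nonneg b'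
  have h3 : 0 ≤ a + b := add_nonneg h1 h2
  obtain ⟨c, hc⟩ := CStarAlgebra.nonneg_iff_eq_star_mul_self.mp h3
  exact ⟨c, hc.symm⟩

/-- `cs_core` in the unit fibre. -/
theorem fib_core {u : H} (hu : 𝒢.rng u = u) (hc : 𝒢.src u = 𝒢.rng u) (hm : 𝒢.mul u u hc = u)
    (hi : 𝒢.inv u = u) (q : Bf u) (hq : FB.nonneg hu q) (s : ℝ) (hs : 0 < s) (hqs : ‖q‖ ≤ s) :
    FB.starT hi q = q ∧ ∃ (l : ℝ) (a : Bf u), FB.starT hi a = a ∧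
      l ^ 2 • q + l • (FB.mulT hc hm q a + FB.mulT hc hm a q) + FB.mulT hc hm (FB.mulT hc hm a q) a
        = (s⁻¹) • q - ((1 / (2 * s)) ^ 2 * s⁻¹) •
          (s ^ 2 • q + (2 * s) • (FB.mulT hc hm q q) + FB.mulT hc hm (FB.mulT hc hm q q) q) := by
  rw [nonneg_iff] at hq
  letI := FB.fibAlg hu
  let _ := CStarAlgebra.spectralOrder (Bf u)
  have _ := CStarAlgebra.spectralOrderedRing (Bf u)
  obtain ⟨a', ha⟩ := hq
  have h1 : 0 ≤ q := ha ▸ star_mul_self_nonneg a'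
  exact ⟨IsSelfAdjoint.of_nonneg h1, cs_core q h1 s hs hqs⟩

end FellBundle

namespace FellBundle

variable {H : Type*} [TopologicalSpace H] {𝒢 : TopGroupoid H}
  {Bf : H → Type*} [∀ g, NormedAddCommGroup (Bf g)] [∀ g, NormedSpace ℂ (Bf g)]
  [∀ g, CompleteSpace (Bf g)] [TopologicalSpace (Σ g, Bf g)] (FB : FellBundle 𝒢 Bf)
  {g h k : H}

theorem rsmul_mulT (hc : 𝒢.src g = 𝒢.rng h) (e : 𝒢.mul g h hc = k) (c : ℝ) (a : Bf g) (b : Bf h) :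
    FB.mulT hc e (c • a) b = c • FB.mulT hc e a b := by
  simpa only [Complex.coe_smul] using FB.smul_mulT hc e (c : ℂ) a b

theorem mulT_rsmul (hc : 𝒢.src g = 𝒢.rng h) (e : 𝒢.mul g h hc = k) (c : ℝ) (a : Bf g) (b : Bf h) :
    FB.mulT hc e a (c • b) = c • FB.mulT hc e a b := by
  simpa only [Complex.coe_smul] using FB.mulT_smul hc e (c : ℂ) a b

theorem starT_rsmul (e : 𝒢.inv g = k) (c : ℝ) (a : Bf g) :
    FB.starT e (c • a) = c • FB.starT e a := by
  simpa only [Complex.coe_smul, Complex.conj_ofReal] using FB.starT_smul e (c : ℂ) a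

end FellBundle

namespace DemiEquiv

variable {H : Type*} [TopologicalSpace H] {𝒢 : TopGroupoid H}
  {Bf : H → Type*} [∀ g, NormedAddCommGroup (Bf g)] [∀ g, NormedSpace ℂ (Bf g)]
  [∀ g, CompleteSpace (Bf g)] [TopologicalSpace (Σ g, Bf g)] {FB : FellBundle 𝒢 Bf}
  {X : Type*} [TopologicalSpace X] {ra : RightGroupoidAction 𝒢 X}
  {Mf : X → Type*} [∀ x, NormedAddCommGroup (Mf x)] [∀ x, NormedSpace ℂ (Mf x)]
  [∀ x, CompleteSpace (Mf x)] [TopologicalSpace (Σ x, Mf x)]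
  (DE : DemiEquiv FB ra Mf)

/-- inner product with a transported fibre -/
def inT {x y : X} {h : H} (hc : ra.anchor x = 𝒢.rng h) (e : ra.act x h hc = y)
    (m : Mf x) (n : Mf y) : Bf h := DE.inner x h hc m (cast (congrArg Mf e.symm) n)

/-- action with a transported target fibre -/
def raT {x y : X} {h : H} (hc : ra.anchor x = 𝒢.rng h) (e : ra.act x h hc = y)
    (m : Mf x) (b : Bf h) : Mf y := cast (congrArg Mf e) (DE.ract x h hc m b)

variable {x y z : X} {h k l : H}

theorem inT_add_left (hc : ra.anchor x = 𝒢.rng h) (e : ra.act x h hc = y) (m m' : Mf x)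
    (n : Mf y) : DE.inT hc e (m + m') n = DE.inT hc e m n + DE.inT hc e m' n := by
  subst e; exact DE.inner_add_left x h hc m m' n

theorem inT_add_right (hc : ra.anchor x = 𝒢.rng h) (e : ra.act x h hc = y) (m : Mf x)
    (n n' : Mf y) : DE.inT hc e m (n + n') = DE.inT hc e m n + DE.inT hc e m n' := by
  subst e; exact DE.inner_add_right x h hc m n n'

theorem inT_smul_left (hc : ra.anchor x = 𝒢.rng h) (e : ra.act x h hc = y) (c : ℝ) (m : Mf x)
    (n : Mf y) : DE.inT hc e (c • m) n = c • DE.inT hc e m n := by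
  subst e
  have := DE.inner_smul_left x h hc (c : ℂ) m n
  simp only [Complex.coe_smul, Complex.conj_ofReal] at this
  exact this

theorem inT_smul_right (hc : ra.anchor x = 𝒢.rng h) (e : ra.act x h hc = y) (c : ℝ) (m : Mf x)
    (n : Mf y) : DE.inT hc e m (c • n) = c • DE.inT hc e m n := by
  subst e
  have := DE.inner_smul_right x h hc (c : ℂ) m n
  simp only [Complex.coe_smul] at this
  exact this

theorem inT_raT (hc : ra.anchor x = 𝒢.rng h) (e : ra.act x h hc = y)
    (hc2 : ra.anchor y = 𝒢.rng k) (e2 : ra.act y k hc2 = z)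
    (hck : 𝒢.src h = 𝒢.rng k) (el : 𝒢.mul h k hck = l)
    (hc3 : ra.anchor x = 𝒢.rng l) (e3 : ra.act x l hc3 = z)
    (m₁ : Mf x) (m₂ : Mf y) (b : Bf k) :
    DE.inT hc3 e3 m₁ (DE.raT hc2 e2 m₂ b) = FB.mulT hck el (DE.inT hc e m₁ m₂) b := by
  subst e el e3
  exact DE.inner_ract x h k hc hck hc2 hc3 e2 m₁ m₂ b

theorem inT_star (hc : ra.anchor x = 𝒢.rng h) (e : ra.act x h hc = y) (ek : 𝒢.inv h = k)
    (hc' : ra.anchor y = 𝒢.rng k) (e' : ra.act y k hc' = x) (m : Mf x) (n : Mf y) :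
    FB.starT ek (DE.inT hc e m n) = DE.inT hc' e' n m := by
  subst e ek
  exact DE.inner_star x h hc hc' e' m n

theorem main_expand (x y : X) (u v h k : H) (hv : ra.anchor x = v) (hu : ra.anchor y = u)
    (hvv : 𝒢.rng v = v) (huu : 𝒢.rng u = u)
    (hk : 𝒢.inv h = k) (hk' : 𝒢.inv k = h) (hiv : 𝒢.inv v = v) (hiu : 𝒢.inv u = u)
    (hsh : 𝒢.src h = u) (hrh : 𝒢.rng h = v) (hsk : 𝒢.src k = v) (hrk : 𝒢.rng k = u)
    (hsu : 𝒢.src u = u)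
    (ahk : 𝒢.src h = 𝒢.rng k) (ehk : 𝒢.mul h k ahk = v)
    (auu : 𝒢.src u = 𝒢.rng u) (euu : 𝒢.mul u u auu = u)
    (auk : 𝒢.src u = 𝒢.rng k) (euk : 𝒢.mul u k auk = k)
    (hc : ra.anchor x = 𝒢.rng h) (e : ra.act x h hc = y)
    (hc' : ra.anchor y = 𝒢.rng k) (e' : ra.act y k hc' = x)
    (hcv : ra.anchor x = 𝒢.rng v) (ev : ra.act x v hcv = x)
    (hcu : ra.anchor y = 𝒢.rng u) (eu : ra.act y u hcu = y)
    (m₁ : Mf x) (m₂ : Mf y) (q : Bf u) (hq : q = DE.inT hcu eu m₂ m₂)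
    (hqs : FB.starT hiu q = q)
    (b : Bf h) (hb : b = DE.inT hc e m₁ m₂) (b' : Bf k) (hb' : b' = FB.starT hk b)
    (Φ : Bf u → Bf v) (hΦ : ∀ c, Φ c = FB.mulT ahk ehk b (FB.mulT auk euk c b'))
    (t l : ℝ) (a : Bf u) (ha : FB.starT hiu a = a) :
    FB.nonneg hvv (t ^ 2 • DE.inT hcv ev m₁ m₁
      - (2 * t) • (l • FB.mulT ahk ehk b b' + Φ a)
      + Φ (l ^ 2 • q + l • (FB.mulT auu euu q a + FB.mulT auu euu a q)
        + FB.mulT auu euu (FB.mulT auu euu a q) a)) := by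
  have ahu : 𝒢.src h = 𝒢.rng u := hsh.trans huu.symm
  have ehu : 𝒢.mul h u ahu = h := 𝒢.mul_right_unit hsh ahu
  set w : Bf k := l • b' + FB.mulT auk euk a b' with hw
  set n : Mf x := DE.raT hc' e' m₂ w with hn
  have hbb : FB.starT hk' b' = b := by rw [hb', FB.starT_starT]
  have i1 : DE.inT hcv ev m₁ n = l • FB.mulT ahk ehk b b' + Φ a := by
    rw [hn, DE.inT_raT hc e hc' e' ahk ehk hcv ev, ← hb, hw, FB.mulT_add, FB.mulT_rsmul, hΦ]
  have i2 : DE.inT hcv ev n m₁ = l • FB.mulT ahk ehk b b' + Φ a := by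
    rw [← DE.inT_star hcv ev hiv hcv ev, i1, FB.starT_add, FB.starT_rsmul, hΦ,
      FB.starT_mulT ahk ehk hk hk' hiv ahk ehk,
      FB.starT_mulT ahk ehk hk hk' hiv ahk ehk,
      FB.starT_mulT auk euk hiu hk' hk' ahu ehu, hbb, ← hb', ha,
      FB.mulT_assoc ahu auk ehu euk ahk ahk ehk ehk]
  have i3 : DE.inT hc' e' m₂ n = FB.mulT auk euk q w := by
    rw [hn, DE.inT_raT hcu eu hc' e' auk euk hc' e', ← hq]
  have i4 : DE.inT hc e n m₂ = FB.mulT ahu ehu b (l • q + FB.mulT auu euu a q) := by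
    have : FB.mulT auk euk q w = FB.mulT auk euk (l • q + FB.mulT auu euu q a) b' := by
      rw [hw, FB.mulT_add, FB.add_mulT, FB.mulT_rsmul, FB.rsmul_mulT,
        FB.mulT_assoc auu auk euu euk auk auk euk euk]
    rw [← DE.inT_star hc' e' hk' hc e, i3, this,
      FB.starT_mulT auk euk hiu hk' hk' ahu ehu, hbb, FB.starT_add, FB.starT_rsmul, hqs,
      FB.starT_mulT auu euu hiu hiu hiu auu euu, ha, hqs]
  have i5 : DE.inT hcv ev n n = Φ (l ^ 2 • q + l • (FB.mulT auu euu q a + FB.mulT auu euu a q)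
        + FB.mulT auu euu (FB.mulT auu euu a q) a) := by
    have : DE.inT hcv ev n n = FB.mulT ahk ehk (DE.inT hc e n m₂) w := by
      conv_lhs => rw [hn]
      exact DE.inT_raT hc e hc' e' ahk ehk hcv ev n m₂ w
    rw [this, i4, FB.mulT_assoc ahu auk ehu euk ahk ahk ehk ehk, hΦ]
    congr 1
    rw [hw]
    simp only [FB.mulT_add, FB.add_mulT, FB.mulT_rsmul, FB.rsmul_mulT, smul_add,
      FB.mulT_assoc auu auk euu euk auk auk euk euk, FB.mulT_assoc auu auu euu euu auu auu euu euu]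
    module
  have pos : FB.nonneg hvv (DE.inT hcv ev (t • m₁ + (-1 : ℝ) • n) (t • m₁ + (-1 : ℝ) • n)) := by
    subst hv
    exact DE.inner_self_nonneg x hcv _
  convert pos using 1
  simp only [DE.inT_add_left, DE.inT_add_right, DE.inT_smul_left, DE.inT_smul_right, i1, i2, ← i5]
  module

end DemiEquiv

/-- **Lemma 2.2** (`lem:rwordBdl are nice`), (DE12): the Cauchy–Schwarz inequality. -/
theorem demiEquiv_cauchy_schwarz
    {H : Type*} [TopologicalSpace H] [LocallyCompactSpace H] [T2Space H]
    {X : Type*} [TopologicalSpace X] [LocallyCompactSpace X] [T2Space X]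
    {𝒢 : TopGroupoid H} (hsrc : 𝒢.OpenSource)
    {Bf : H → Type*} [∀ g, NormedAddCommGroup (Bf g)] [∀ g, NormedSpace ℂ (Bf g)]
    [∀ g, CompleteSpace (Bf g)] [TopologicalSpace (Σ g, Bf g)]
    (FB : FellBundle 𝒢 Bf)
    {ra : RightGroupoidAction 𝒢 X} (hprin : ra.IsPrincipal)
    (hopen : ra.OpenAnchor) (hsurj : ra.SurjAnchor)
    {Mf : X → Type*} [∀ x, NormedAddCommGroup (Mf x)] [∀ x, NormedSpace ℂ (Mf x)]
    [∀ x, CompleteSpace (Mf x)] [TopologicalSpace (Σ x, Mf x)]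
    (DE : DemiEquiv FB ra Mf) :
    ∀ (x : X) (h : H) (hc : ra.anchor x = 𝒢.rng h)
      (hc₀ : ra.anchor x = 𝒢.rng (ra.anchor x))
      (hmulinv : 𝒢.mul h (𝒢.inv h) (𝒢.rng_inv h).symm = ra.anchor x)
      (m₁ : Mf x) (m₂ : Mf (ra.act x h hc)),
      -- ⟨m₁, m₂⟩ ⟨m₁, m₂⟩* ≤ ‖m₂‖² • ⟨m₁, m₁⟩ in the C*-algebra B(σ(m₁))
      FB.le (ra.anchor_unit x)
        (cast (congrArg Bf hmulinv)
          (FB.mul (𝒢.rng_inv h).symm (DE.inner x h hc m₁ m₂)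
            (FB.star' (DE.inner x h hc m₁ m₂))))
        ((‖m₂‖ ^ 2 : ℝ) •
          DE.inner x (ra.anchor x) hc₀ m₁
            (cast (congrArg Mf (ra.act_unit x hc₀).symm) m₁)) := by
  intro x h hc hc₀ hmulinv m₁ m₂
  obtain ⟨y, hy⟩ : ∃ y, y = ra.act x h hc := ⟨_, rfl⟩
  obtain ⟨u, hu⟩ : ∃ u, ra.anchor (ra.act x h hc) = u := ⟨_, rfl⟩
  have huu : 𝒢.rng u = u := by rw [← hu]; exact ra.anchor_unit _
  have hsh : 𝒢.src h = u := by rw [← hu, ra.anchor_act]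
  have hvv := ra.anchor_unit x
  have hiv := 𝒢.inv_of_unit hvv
  have hiu := 𝒢.inv_of_unit huu
  have hsu := 𝒢.src_of_unit huu
  have hrk : 𝒢.rng (𝒢.inv h) = u := (𝒢.rng_inv h).trans hsh
  have hsk : 𝒢.src (𝒢.inv h) = ra.anchor x := (𝒢.src_inv h).trans hc.symm
  have auu : 𝒢.src u = 𝒢.rng u := hsu.trans huu.symm
  have euu : 𝒢.mul u u auu = u := 𝒢.mul_left_unit huu auu
  have auk : 𝒢.src u = 𝒢.rng (𝒢.inv h) := hsu.trans hrk.symm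
  have euk : 𝒢.mul u (𝒢.inv h) auk = 𝒢.inv h := 𝒢.mul_left_unit hrk auk
  have hc' : ra.anchor (ra.act x h hc) = 𝒢.rng (𝒢.inv h) := hu.trans hrk.symm
  have e' : ra.act (ra.act x h hc) (𝒢.inv h) hc' = x := by
    rw [ra.act_mul x h (𝒢.inv h) hc hc' (𝒢.rng_inv h).symm (by rw [hmulinv]; exact hc₀)]
    simp only [hmulinv]
    exact ra.act_unit x hc₀
  have hcu : ra.anchor (ra.act x h hc) = 𝒢.rng u := hu.trans huu.symm
  have eu : ra.act (ra.act x h hc) u hcu = ra.act x h hc := by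
    subst hu
    exact ra.act_unit _ hcu
  have qpos : FB.nonneg huu (DE.inT hcu eu m₂ m₂) := by
    subst hu
    exact DE.inner_self_nonneg _ hcu m₂
  have qnorm : ‖m₂‖ ^ 2 = ‖DE.inT hcu eu m₂ m₂‖ := by
    subst hu
    rw [DE.norm_eq _ hcu m₂, Real.sq_sqrt (norm_nonneg _)]
    rfl
  let Φ : Bf u → Bf (ra.anchor x) := fun c =>
    FB.mulT (𝒢.rng_inv h).symm hmulinv (DE.inner x h hc m₁ m₂)
      (FB.mulT auk euk c (FB.starT rfl (DE.inner x h hc m₁ m₂)))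
  have Φadd : ∀ c d, Φ (c + d) = Φ c + Φ d := fun c d => by
    simp only [Φ, FB.add_mulT, FB.mulT_add]
  have Φsmul : ∀ (r : ℝ) c, Φ (r • c) = r • Φ c := fun r c => by
    simp only [Φ, FB.rsmul_mulT, FB.mulT_rsmul]
  have hev : ra.act x (ra.anchor x) hc₀ = x := ra.act_unit x hc₀
  change FB.nonneg (ra.anchor_unit x) (‖m₂‖ ^ 2 • DE.inT hc₀ hev m₁ m₁ -
    FB.mulT (𝒢.rng_inv h).symm hmulinv (DE.inner x h hc m₁ m₂)
      (FB.starT rfl (DE.inner x h hc m₁ m₂)))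
  rcases eq_or_ne m₂ 0 with h0 | h0
  · have : DE.inner x h hc m₁ m₂ = 0 := by
      have := DE.inner_smul_right x h hc 0 m₁ m₂
      rw [h0] at this ⊢
      simpa using this
    rw [this, FB.zero_mulT, h0]
    have h2 := DE.inner_self_nonneg x hc₀ ((0 : ℝ) • m₁)
    have h3 : DE.inT hc₀ hev ((0 : ℝ) • m₁) ((0 : ℝ) • m₁) = 0 := by
      rw [DE.inT_smul_left]; simp
    simp only [norm_zero, ne_eq, OfNat.ofNat_ne_zero, not_false_eq_true, zero_pow, zero_smul,
      sub_zero]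
    rw [← h3]
    exact h2
  have hs : 0 < ‖m₂‖ ^ 2 := by positivity
  obtain ⟨hqs, l, a, ha, hl⟩ := FB.fib_core huu auu euu hiu _ qpos _ hs qnorm.ge
  have main := DE.main_expand x (ra.act x h hc) u (ra.anchor x) h (𝒢.inv h) rfl hu hvv huu rfl
    (𝒢.inv_inv_aux h) hiv hiu hsh hc.symm hsk hrk hsu (𝒢.rng_inv h).symm hmulinv auu euu auk euk
    hc rfl hc' e' hc₀ hev hcu eu m₁ m₂ _ rfl hqs _ rfl _ rfl Φ (fun _ => rfl)
  have m1 := main 0 l a ha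
  have m2 := main ‖m₂‖ (2 * ‖m₂‖)⁻¹ (((2 * ‖m₂‖ ^ 3)⁻¹ : ℝ) • DE.inT hcu eu m₂ m₂)
    (by rw [FB.starT_rsmul, hqs])
  have h3 := FB.nonneg_add _ m1 m2
  convert h3 using 1
  have hn : ‖m₂‖ ≠ 0 := by positivity
  rw [hl, sub_eq_add_neg (_ • DE.inT hcu eu m₂ m₂), ← neg_smul]
  simp only [FB.mulT_rsmul, FB.rsmul_mulT, Φadd, Φsmul]
  change _ • _ - FB.mulT (𝒢.rng_inv h).symm hmulinv (DE.inner x h hc m₁ m₂)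
      (FB.starT rfl (DE.inner x h hc m₁ m₂)) = (_ - _ • (_ • FB.mulT (𝒢.rng_inv h).symm hmulinv (DE.inner x h hc m₁ m₂)
      (FB.starT rfl (DE.inner x h hc m₁ m₂)) + _) + _) + (_ - _ • (_ • FB.mulT (𝒢.rng_inv h).symm hmulinv (DE.inner x h hc m₁ m₂)
      (FB.starT rfl (DE.inner x h hc m₁ m₂)) + _) + _)
  match_scalars <;> field_simp <;> ring
end

section
/- Let B be a Fell bundle over a groupoid H, M a right B-demi-equivalence over a principal H-space X, and for composable h ∈ uHv define fibre maps Ψ_h : M(x·h) ⊗_{B(v)} M(y)^op → M(x) ⊗_{B(u)} M(y·h⁻¹)^op determined on elementary tensors by (m ⊳ b) ⊗ n^op ↦ m ⊗ (n ⊳ b*)^op for b ∈ B(h). Then each Ψ_h is a well-defined linear isometry, Ψ_{h'} ∘ Ψ_h = Ψ_{h'h} for composable h',h, Ψ_{h⁻¹} = Ψ_h⁻¹, and Ψ_u = id for units u. -/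
namespace DemiEquiv

variable {H : Type*} [TopologicalSpace H] {𝒢 : TopGroupoid H}
  {Bf : H → Type*} [∀ g, NormedAddCommGroup (Bf g)] [∀ g, NormedSpace ℂ (Bf g)]
  [∀ g, CompleteSpace (Bf g)] [TopologicalSpace (Σ g, Bf g)]
  {FB : FellBundle 𝒢 Bf}
  {X : Type*} [TopologicalSpace X] {ra : RightGroupoidAction 𝒢 X}
  {Mf : X → Type*} [∀ x, NormedAddCommGroup (Mf x)] [∀ x, NormedSpace ℂ (Mf x)]
  [∀ x, CompleteSpace (Mf x)] [TopologicalSpace (Σ x, Mf x)]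

/-- The action of the unit-fibre C*-algebra `B(σ(x))` on the fibre `M(x)`. -/
def uact (DE : DemiEquiv FB ra Mf) (x : X) (m : Mf x) (b : Bf (ra.anchor x)) : Mf x :=
  cast (congrArg Mf (ra.act_unit x (ra.anchor_unit x).symm))
    (DE.ract x (ra.anchor x) (ra.anchor_unit x).symm m b)

/-- The `B(σ(x))`-valued inner product on the fibre `M(x)`. -/
def uinner (DE : DemiEquiv FB ra Mf) (x : X) (m n : Mf x) : Bf (ra.anchor x) :=
  DE.inner x (ra.anchor x) (ra.anchor_unit x).symm m
    (cast (congrArg Mf (ra.act_unit x (ra.anchor_unit x).symm).symm) n)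

end DemiEquiv

/-- A realization of the balanced tensor product `M(x) ⊗_{B(u)} M(y)^op` of two fibres of a
demi-equivalence over points with the same anchor `u = σ(x) = σ(y)`: a Banach space `T` with
a bilinear (linear–conjugate-linear) `B(u)`-balanced map of total range, carrying the norm of
`K_{B(u)}(M(y), M(x))`. -/
structure FibreTensor {H : Type*} [TopologicalSpace H] {𝒢 : TopGroupoid H}
    {Bf : H → Type*} [∀ g, NormedAddCommGroup (Bf g)] [∀ g, NormedSpace ℂ (Bf g)]
    [∀ g, CompleteSpace (Bf g)] [TopologicalSpace (Σ g, Bf g)]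
    {FB : FellBundle 𝒢 Bf}
    {X : Type*} [TopologicalSpace X] {ra : RightGroupoidAction 𝒢 X}
    {Mf : X → Type*} [∀ x, NormedAddCommGroup (Mf x)] [∀ x, NormedSpace ℂ (Mf x)]
    [∀ x, CompleteSpace (Mf x)] [TopologicalSpace (Σ x, Mf x)]
    (DE : DemiEquiv FB ra Mf) (x y : X)
    (hxy : ra.anchor x = ra.anchor y)
    (hinv : 𝒢.inv (ra.anchor x) = ra.anchor y)
    (T : Type*) [NormedAddCommGroup T] [NormedSpace ℂ T] [CompleteSpace T] : Type _ where
  t : Mf x → Mf y → T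
  add_left : ∀ m m' n, t (m + m') n = t m n + t m' n
  smul_left : ∀ (c : ℂ) m n, t (c • m) n = c • t m n
  add_right : ∀ m n n', t m (n + n') = t m n + t m n'
  conj_smul_right : ∀ (c : ℂ) m n, t m (c • n) = (starRingEnd ℂ c) • t m n
  balanced : ∀ (m : Mf x) (n : Mf y) (b : Bf (ra.anchor x)),
    t (DE.uact x m b) n = t m (DE.uact y n (cast (congrArg Bf hinv) (FB.star' b)))
  dense_span : Dense ((Submodule.span ℂ {z : T | ∃ m n, z = t m n} : Submodule ℂ T) : Set T)
  norm_eq : ∀ (k : ℕ) (m : Fin k → Mf x) (n : Fin k → Mf y),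
    ‖∑ i, t (m i) (n i)‖ = ⨆ z : {z : Mf y // ‖z‖ ≤ 1},
      ‖∑ i, DE.uact x (m i) (cast (congrArg Bf hxy.symm) (DE.uinner y (n i) z.1))‖

/-- A packaged realization of `M(x) ⊗_{B(u)} M(y)^op`. -/
structure FibreTensorPkg {H : Type*} [TopologicalSpace H] {𝒢 : TopGroupoid H}
    {Bf : H → Type*} [∀ g, NormedAddCommGroup (Bf g)] [∀ g, NormedSpace ℂ (Bf g)]
    [∀ g, CompleteSpace (Bf g)] [TopologicalSpace (Σ g, Bf g)]
    {FB : FellBundle 𝒢 Bf}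
    {X : Type*} [TopologicalSpace X] {ra : RightGroupoidAction 𝒢 X}
    {Mf : X → Type*} [∀ x, NormedAddCommGroup (Mf x)] [∀ x, NormedSpace ℂ (Mf x)]
    [∀ x, CompleteSpace (Mf x)] [TopologicalSpace (Σ x, Mf x)]
    (DE : DemiEquiv FB ra Mf) (x y : X)
    (hxy : ra.anchor x = ra.anchor y)
    (hinv : 𝒢.inv (ra.anchor x) = ra.anchor y) : Type _ where
  T : Type
  [nacg : NormedAddCommGroup T]
  [nsp : NormedSpace ℂ T]
  [cmpl : CompleteSpace T]
  R : FibreTensor DE x y hxy hinv T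

attribute [instance] FibreTensorPkg.nacg FibreTensorPkg.nsp FibreTensorPkg.cmpl


namespace PsiAux

section alg
variable {H : Type*} [TopologicalSpace H] {𝒢 : TopGroupoid H}

/-- `k` is the product `g h`. -/
def MRel (𝒢 : TopGroupoid H) (g h k : H) : Prop := ∃ hs : 𝒢.src g = 𝒢.rng h, 𝒢.mul g h hs = k

theorem unit_src {u : H} (hu : 𝒢.rng u = u) : 𝒢.src u = u := by
  have := 𝒢.src_rng u
  rwa [hu] at this

theorem mul_src_of {g u : H} (h : 𝒢.src g = u) : MRel 𝒢 g u g := by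
  subst h
  exact ⟨(𝒢.rng_src g).symm, 𝒢.mul_src _ _⟩

theorem rng_mul_of {g u : H} (h : 𝒢.rng g = u) : MRel 𝒢 u g g := by
  subst h
  exact ⟨𝒢.src_rng g, 𝒢.rng_mul' _ _⟩

theorem unit_mul {u : H} (hu : 𝒢.rng u = u) : MRel 𝒢 u u u := rng_mul_of hu

theorem MRel.unique {g h k k' : H} (r : MRel 𝒢 g h k) (r' : MRel 𝒢 g h k') : k = k' := by
  obtain ⟨_, rfl⟩ := r
  obtain ⟨_, rfl⟩ := r'
  rfl

theorem mrel_inv_mul (g : H) : MRel 𝒢 (𝒢.inv g) g (𝒢.src g) := ⟨𝒢.src_inv g, 𝒢.inv_mul _ _⟩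
theorem mrel_mul_inv (g : H) : MRel 𝒢 g (𝒢.inv g) (𝒢.rng g) :=
  ⟨(𝒢.rng_inv g).symm, 𝒢.mul_inv _ _⟩

theorem MRel.assoc {a b c ab bc abc : H} (r1 : MRel 𝒢 a b ab) (r2 : MRel 𝒢 b c bc)
    (r3 : MRel 𝒢 ab c abc) : MRel 𝒢 a bc abc := by
  obtain ⟨h1, rfl⟩ := r1
  obtain ⟨h2, rfl⟩ := r2
  obtain ⟨h3, rfl⟩ := r3
  have h4 : 𝒢.src a = 𝒢.rng (𝒢.mul b c h2) := by rw [𝒢.rng_mul]; exact h1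
  exact ⟨h4, (𝒢.mul_assoc _ _ _ _ _ _ _).symm⟩

theorem MRel.assoc' {a b c ab bc abc : H} (r1 : MRel 𝒢 a b ab) (r2 : MRel 𝒢 b c bc)
    (r3 : MRel 𝒢 a bc abc) : MRel 𝒢 ab c abc := by
  obtain ⟨h1, rfl⟩ := r1
  obtain ⟨h2, rfl⟩ := r2
  obtain ⟨h3, rfl⟩ := r3
  have h4 : 𝒢.src (𝒢.mul a b h1) = 𝒢.rng c := by rw [𝒢.src_mul]; exact h2
  exact ⟨h4, (𝒢.mul_assoc _ _ _ _ _ _ _)⟩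

theorem MRel.src {a b ab : H} (r1 : MRel 𝒢 a b ab) : 𝒢.src ab = 𝒢.src b := by
  obtain ⟨h1, rfl⟩ := r1
  exact 𝒢.src_mul _ _ _

theorem MRel.rng {a b ab : H} (r1 : MRel 𝒢 a b ab) : 𝒢.rng ab = 𝒢.rng a := by
  obtain ⟨h1, rfl⟩ := r1
  exact 𝒢.rng_mul _ _ _

/-- if `a b = ab` then `a⁻¹ (ab) = b`. -/
theorem MRel.inv_left {a b ab : H} (r1 : MRel 𝒢 a b ab) : MRel 𝒢 (𝒢.inv a) ab b :=
  MRel.assoc (mrel_inv_mul a) r1 (rng_mul_of r1.1.symm)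

theorem MRel.inv_right {a b ab : H} (r1 : MRel 𝒢 a b ab) : MRel 𝒢 ab (𝒢.inv b) a := by
  refine MRel.assoc' r1 (mrel_mul_inv b) (mul_src_of r1.1)

theorem inv_inv (a : H) : 𝒢.inv (𝒢.inv a) = a := by
  have h1 : MRel 𝒢 (𝒢.inv (𝒢.inv a)) (𝒢.src a) a := (mrel_inv_mul (𝒢 := 𝒢) a).inv_left
  have h2 : MRel 𝒢 (𝒢.inv (𝒢.inv a)) (𝒢.src a) (𝒢.inv (𝒢.inv a)) := by
    apply mul_src_of
    rw [𝒢.src_inv, 𝒢.rng_inv]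
  exact h2.unique h1

theorem MRel.inv {a b ab : H} (r1 : MRel 𝒢 a b ab) : MRel 𝒢 (𝒢.inv b) (𝒢.inv a) (𝒢.inv ab) := by
  have h1 : MRel 𝒢 b (𝒢.inv ab) (𝒢.inv a) := by
    have := r1.inv_left.inv_right
    exact this
  exact h1.inv_left

theorem unit_inv {u : H} (hu : 𝒢.rng u = u) : 𝒢.inv u = u := by
  have h1 : MRel 𝒢 (𝒢.inv u) u u := by simpa [unit_src hu] using mrel_inv_mul (𝒢 := 𝒢) u
  have h2 : MRel 𝒢 (𝒢.inv u) u (𝒢.inv u) := mul_src_of (by rw [𝒢.src_inv, hu])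
  exact h2.unique h1

variable {Bf : H → Type*} [∀ g, NormedAddCommGroup (Bf g)] [∀ g, NormedSpace ℂ (Bf g)]
  [∀ g, CompleteSpace (Bf g)] [TopologicalSpace (Σ g, Bf g)] (FB : FellBundle 𝒢 Bf)

/-- Multiplication with a free target. -/
def Mu {g h k : H} (r : MRel 𝒢 g h k) (a : Bf g) (b : Bf h) : Bf k :=
  cast (congrArg Bf r.snd) (FB.mul r.fst a b)

/-- Involution with a free target. -/
def St {g k : H} (r : 𝒢.inv g = k) (a : Bf g) : Bf k := cast (congrArg Bf r) (FB.star' a)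

variable {FB}

theorem Mu_add {g h k : H} (r : MRel 𝒢 g h k) (a : Bf g) (b b' : Bf h) :
    Mu FB r a (b + b') = Mu FB r a b + Mu FB r a b' := by
  obtain ⟨h1, rfl⟩ := r
  exact FB.mul_add _ _ _ _
theorem add_Mu {g h k : H} (r : MRel 𝒢 g h k) (a a' : Bf g) (b : Bf h) :
    Mu FB r (a + a') b = Mu FB r a b + Mu FB r a' b := by
  obtain ⟨h1, rfl⟩ := r
  exact FB.add_mul _ _ _ _
theorem Mu_smul {g h k : H} (r : MRel 𝒢 g h k) (c : ℂ) (a : Bf g) (b : Bf h) :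
    Mu FB r a (c • b) = c • Mu FB r a b := by
  obtain ⟨h1, rfl⟩ := r
  exact FB.mul_smul' _ _ _ _
theorem smul_Mu {g h k : H} (r : MRel 𝒢 g h k) (c : ℂ) (a : Bf g) (b : Bf h) :
    Mu FB r (c • a) b = c • Mu FB r a b := by
  obtain ⟨h1, rfl⟩ := r
  exact FB.mul_smul _ _ _ _
theorem norm_Mu {g h k : H} (r : MRel 𝒢 g h k) (a : Bf g) (b : Bf h) :
    ‖Mu FB r a b‖ ≤ ‖a‖ * ‖b‖ := by
  obtain ⟨h1, rfl⟩ := r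
  exact FB.norm_mul_le _ _ _
theorem Mu_assoc {a b c ab bc abc : H} (r1 : MRel 𝒢 a b ab) (r2 : MRel 𝒢 b c bc)
    (r3 : MRel 𝒢 ab c abc) (r4 : MRel 𝒢 a bc abc) (p : Bf a) (q : Bf b) (r : Bf c) :
    Mu FB r3 (Mu FB r1 p q) r = Mu FB r4 p (Mu FB r2 q r) := by
  obtain ⟨h1, rfl⟩ := r1
  obtain ⟨h2, rfl⟩ := r2
  obtain ⟨h3, rfl⟩ := r3
  obtain ⟨h4, h5⟩ := r4
  apply eq_of_heq
  refine HEq.trans (FB.mul_assoc h1 h2 h3 h4 p q r) ?_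
  exact (cast_heq _ _).symm
theorem St_add {g k : H} (r : 𝒢.inv g = k) (a b : Bf g) :
    St FB r (a + b) = St FB r a + St FB r b := by
  subst r; exact FB.star_add _ _
theorem St_smul {g k : H} (r : 𝒢.inv g = k) (c : ℂ) (a : Bf g) :
    St FB r (c • a) = (starRingEnd ℂ c) • St FB r a := by
  subst r; exact FB.star_smul _ _
theorem St_St {g k : H} (r : 𝒢.inv g = k) (r' : 𝒢.inv k = g) (a : Bf g) :
    St FB r' (St FB r a) = a := by
  subst r
  exact eq_of_heq ((cast_heq _ _).trans (FB.star_star a))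
theorem norm_St {g k : H} (r : 𝒢.inv g = k) (a : Bf g) : ‖St FB r a‖ = ‖a‖ := by
  subst r; exact FB.norm_star _
theorem St_Mu {g h k g' h' k' : H} (r : MRel 𝒢 g h k) (rg : 𝒢.inv g = g') (rh : 𝒢.inv h = h')
    (rk : 𝒢.inv k = k') (r' : MRel 𝒢 h' g' k') (a : Bf g) (b : Bf h) :
    St FB rk (Mu FB r a b) = Mu FB r' (St FB rh b) (St FB rg a) := by
  obtain ⟨h1, rfl⟩ := r
  subst rg rh rk
  obtain ⟨h4, h5⟩ := r'
  exact eq_of_heq ((FB.star_mul h1 h4 a b).trans (cast_heq _ _).symm)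
theorem norm_St_Mu {g g' k : H} (rg : 𝒢.inv g = g') (r : MRel 𝒢 g' g k) (a : Bf g) :
    ‖Mu FB r (St FB rg a) a‖ = ‖a‖ ^ 2 := by
  subst rg
  obtain ⟨h1, rfl⟩ := r
  exact FB.cstar_norm h1 a
theorem norm_Mu_St {g g' k : H} (rg : 𝒢.inv g = g') (r : MRel 𝒢 g g' k) (a : Bf g) :
    ‖Mu FB r a (St FB rg a)‖ = ‖a‖ ^ 2 := by
  have hg : 𝒢.inv g' = g := by rw [← rg, inv_inv]
  have := norm_St_Mu (FB := FB) hg r (St FB rg a)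
  rwa [St_St, norm_St] at this
theorem Mu_dense {g h k : H} (r : MRel 𝒢 g h k) :
    Dense ((Submodule.span ℂ {c : Bf k | ∃ a b, c = Mu FB r a b} : Submodule ℂ (Bf k)) :
      Set (Bf k)) := by
  obtain ⟨h1, rfl⟩ := r
  exact FB.saturated h1

/-- The opposite algebra of the unit fibre. -/
@[reducible] noncomputable def unitAlg (FB : FellBundle 𝒢 Bf) {u : H} (hu : 𝒢.rng u = u) :
    NonUnitalCStarAlgebra (Bf u) :=
  { (inferInstance : NormedAddCommGroup (Bf u)), (inferInstance : NormedSpace ℂ (Bf u)),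
    (inferInstance : CompleteSpace (Bf u)) with
    mul := fun a b => Mu FB (unit_mul hu) b a
    left_distrib := fun a b c => add_Mu _ _ _ _
    right_distrib := fun a b c => Mu_add _ _ _ _
    zero_mul := fun a => by
      change Mu FB (unit_mul hu) a 0 = 0
      simpa using Mu_smul (FB := FB) (unit_mul hu) 0 a 0
    mul_zero := fun a => by
      change Mu FB (unit_mul hu) 0 a = 0
      simpa using smul_Mu (FB := FB) (unit_mul hu) 0 0 a
    mul_assoc := fun a b c => (Mu_assoc _ _ _ _ _ _ _).symm
    norm_mul_le := fun a b => (norm_Mu _ _ _).trans_eq (mul_comm _ _)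
    star := fun a => St FB (unit_inv hu) a
    star_involutive := fun a => St_St _ _ _
    star_mul := fun a b => St_Mu _ _ _ _ _ _ _
    star_add := fun a b => St_add _ _ _
    norm_mul_self_le := fun a => by
      change ‖a‖ * ‖a‖ ≤ ‖Mu FB (unit_mul hu) a (St FB (unit_inv hu) a)‖
      rw [norm_Mu_St, sq]
    smul_assoc := fun c a b => Mu_smul _ _ _ _
    smul_comm := fun c a b => (smul_Mu _ _ _ _).symm
    star_smul := fun c a => St_smul _ _ _ }

end alg

end PsiAux


namespace PsiAux

section mod
variable {H : Type*} [TopologicalSpace H] {𝒢 : TopGroupoid H}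
  {Bf : H → Type*} [∀ g, NormedAddCommGroup (Bf g)] [∀ g, NormedSpace ℂ (Bf g)]
  [∀ g, CompleteSpace (Bf g)] [TopologicalSpace (Σ g, Bf g)]
  {FB : FellBundle 𝒢 Bf}
  {X : Type*} [TopologicalSpace X] {ra : RightGroupoidAction 𝒢 X}
  {Mf : X → Type*} [∀ x, NormedAddCommGroup (Mf x)] [∀ x, NormedSpace ℂ (Mf x)]
  [∀ x, CompleteSpace (Mf x)] [TopologicalSpace (Σ x, Mf x)]

/-- `x1 = x · h`. -/
def Rel (ra : RightGroupoidAction 𝒢 X) (x : X) (h : H) (x1 : X) : Prop :=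
  ∃ hc : ra.anchor x = 𝒢.rng h, ra.act x h hc = x1

theorem Rel.anchor1 {x x1 : X} {h : H} (r : Rel ra x h x1) : ra.anchor x1 = 𝒢.src h := by
  obtain ⟨hc, rfl⟩ := r
  exact ra.anchor_act _ _ _

theorem relU (x : X) : Rel ra x (ra.anchor x) x := ⟨(ra.anchor_unit x).symm, ra.act_unit _ _⟩

theorem relU' {x : X} {u : H} (h : ra.anchor x = u) : Rel ra x u x := by
  subst h; exact relU x

theorem Rel.mul {x x1 x2 : X} {h k l : H} (r1 : Rel ra x h x1) (r2 : Rel ra x1 k x2)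
    (m : MRel 𝒢 h k l) : Rel ra x l x2 := by
  obtain ⟨hc, rfl⟩ := r1
  obtain ⟨hc2, rfl⟩ := r2
  obtain ⟨hs, rfl⟩ := m
  have : ra.anchor x = 𝒢.rng (𝒢.mul h k hs) := by rw [𝒢.rng_mul]; exact hc
  exact ⟨this, (ra.act_mul _ _ _ _ _ _ _).symm⟩

theorem Rel.inv {x x1 : X} {h : H} (r1 : Rel ra x h x1) : Rel ra x1 (𝒢.inv h) x := by
  have h2 : ra.anchor x1 = 𝒢.rng (𝒢.inv h) := by rw [r1.anchor1, 𝒢.rng_inv]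
  have r2 : Rel ra x1 (𝒢.inv h) (ra.act x1 (𝒢.inv h) h2) := ⟨h2, rfl⟩
  have r3 := r1.mul r2 (mrel_mul_inv h)
  obtain ⟨h3, h4⟩ := r3
  obtain ⟨h5, h6⟩ := relU' (ra := ra) r1.1
  exact ⟨h2, h4.symm.trans h6⟩

theorem Rel.unit1 {x x1 : X} {h : H} (r1 : Rel ra x h x1) : Rel ra x1 (𝒢.src h) x1 :=
  relU' r1.anchor1
theorem Rel.unit0 {x x1 : X} {h : H} (r1 : Rel ra x h x1) : Rel ra x (𝒢.rng h) x :=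
  relU' r1.1

/-- Right action with free target. -/
def A (DE : DemiEquiv FB ra Mf) {x x1 : X} {h : H} (r : Rel ra x h x1) (m : Mf x) (b : Bf h) :
    Mf x1 := cast (congrArg Mf r.snd) (DE.ract x h r.fst m b)

/-- Inner product with free target. -/
def I (DE : DemiEquiv FB ra Mf) {x x1 : X} {h : H} (r : Rel ra x h x1) (m : Mf x) (n : Mf x1) :
    Bf h := DE.inner x h r.fst m (cast (congrArg Mf r.snd.symm) n)

variable {DE : DemiEquiv FB ra Mf}

theorem I_add_right {x x1 : X} {h : H} (r : Rel ra x h x1) (m : Mf x) (n n' : Mf x1) :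
    I DE r m (n + n') = I DE r m n + I DE r m n' := by
  obtain ⟨hc, rfl⟩ := r
  exact DE.inner_add_right _ _ _ _ _ _
theorem I_smul_right {x x1 : X} {h : H} (r : Rel ra x h x1) (c : ℂ) (m : Mf x) (n : Mf x1) :
    I DE r m (c • n) = c • I DE r m n := by
  obtain ⟨hc, rfl⟩ := r
  exact DE.inner_smul_right _ _ _ _ _ _
theorem I_add_left {x x1 : X} {h : H} (r : Rel ra x h x1) (m m' : Mf x) (n : Mf x1) :
    I DE r (m + m') n = I DE r m n + I DE r m' n := by
  obtain ⟨hc, rfl⟩ := r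
  exact DE.inner_add_left _ _ _ _ _ _
theorem I_sub_right {x x1 : X} {h : H} (r : Rel ra x h x1) (m : Mf x) (n n' : Mf x1) :
    I DE r m (n - n') = I DE r m n - I DE r m n' := by
  rw [eq_sub_iff_add_eq, ← I_add_right, sub_add_cancel]
theorem I_sub_left {x x1 : X} {h : H} (r : Rel ra x h x1) (m m' : Mf x) (n : Mf x1) :
    I DE r (m - m') n = I DE r m n - I DE r m' n := by
  rw [eq_sub_iff_add_eq, ← I_add_left, sub_add_cancel]

theorem I_A {x x1 x2 : X} {h k l : H} (r1 : Rel ra x h x1) (r2 : Rel ra x1 k x2)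
    (m : MRel 𝒢 h k l) (r3 : Rel ra x l x2) (p : Mf x) (q : Mf x1) (b : Bf k) :
    I DE r3 p (A DE r2 q b) = Mu FB m (I DE r1 p q) b := by
  obtain ⟨hc, rfl⟩ := r1
  obtain ⟨hs, rfl⟩ := m
  obtain ⟨hc3, rfl⟩ := r3
  obtain ⟨hc2, e⟩ := r2
  exact DE.inner_ract x h k hc hs hc2 hc3 e p q b

theorem St_I {x x1 : X} {h h' : H} (r : Rel ra x h x1) (e : 𝒢.inv h = h') (r' : Rel ra x1 h' x)
    (m : Mf x) (n : Mf x1) : St FB e (I DE r m n) = I DE r' n m := by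
  subst e
  obtain ⟨hc, rfl⟩ := r
  obtain ⟨hc', e⟩ := r'
  exact DE.inner_star x h hc hc' e m n

theorem A_I {x x1 x2 : X} {h h' k l : H} (r1 : Rel ra x h x1) (e : 𝒢.inv h = h')
    (r2 : Rel ra x l x2) (r3 : Rel ra x1 k x2) (m : MRel 𝒢 h' l k)
    (p : Mf x) (b : Bf h) (q : Mf x2) :
    I DE r3 (A DE r1 p b) q = Mu FB m (St FB e b) (I DE r2 p q) := by
  subst e
  have m' : MRel 𝒢 (𝒢.inv l) h (𝒢.inv k) := by
    have := m.inv
    rwa [inv_inv] at this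
  rw [← St_I r3.inv (inv_inv k), I_A r2.inv r1 m' r3.inv,
    St_Mu m' (inv_inv l) rfl (inv_inv k) m, St_I r2.inv (inv_inv l) r2]

theorem unit_eq {x : X} {u : H} (r : Rel ra x u x) (hu : 𝒢.rng u = u) : ra.anchor x = u :=
  r.1.trans hu

theorem norm_eq_sqrt {x : X} {u : H} (r : Rel ra x u x) (hu : 𝒢.rng u = u) (m : Mf x) :
    ‖m‖ = Real.sqrt ‖I DE r m m‖ := by
  obtain rfl := unit_eq r hu
  exact DE.norm_eq x _ m

theorem norm_sq {x : X} {u : H} (r : Rel ra x u x) (hu : 𝒢.rng u = u) (m : Mf x) :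
    ‖m‖ ^ 2 = ‖I DE r m m‖ := by
  rw [norm_eq_sqrt (DE := DE) r hu, Real.sq_sqrt (norm_nonneg _)]

theorem I_def {x : X} {u : H} (r : Rel ra x u x) (hu : 𝒢.rng u = u) (m : Mf x)
    (h : I DE r m m = 0) : m = 0 := by
  obtain rfl := unit_eq r hu
  exact DE.inner_self_eq_zero x _ m h

theorem I_pos {x : X} {u : H} (r : Rel ra x u x) (hu : 𝒢.rng u = u) (m : Mf x) :
    ∃ a : Bf u, I DE r m m = Mu FB (unit_mul hu) (St FB (unit_inv hu) a) a := by
  obtain rfl := unit_eq r hu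
  obtain ⟨a, ha⟩ := DE.inner_self_nonneg x r.1 m
  refine ⟨a, ?_⟩
  refine eq_of_heq (ha.symm.trans ?_)
  have key : ∀ (g k : H) (e : 𝒢.inv (ra.anchor x) = g) (r' : MRel 𝒢 g (ra.anchor x) k),
      HEq (FB.mul (𝒢.src_inv (ra.anchor x)) (FB.star' a) a) (Mu FB r' (St FB e a) a) := by
    rintro g k rfl ⟨h, rfl⟩
    exact HEq.rfl
  exact key _ _ _ _

theorem I_ext {x : X} {u : H} (r : Rel ra x u x) (hu : 𝒢.rng u = u) {m m' : Mf x}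
    (h : ∀ n, I DE r n m = I DE r n m') : m = m' := by
  rw [← sub_eq_zero]
  apply I_def (DE := DE) r hu
  rw [I_sub_right, h, sub_self]

theorem I_A1 {x x1 : X} {h : H} (r : Rel ra x h x1) (n : Mf x1) (m : Mf x) (b : Bf h) :
    I DE r.unit1 n (A DE r m b) = Mu FB (mrel_inv_mul h) (I DE r.inv n m) b :=
  I_A _ _ _ _ _ _ _

theorem A_ext {x1 : X} (v : H) (r : Rel ra x1 (𝒢.src v) x1) {m m' : Mf x1}
    (h : ∀ n, I DE r n m = I DE r n m') : m = m' := I_ext r (𝒢.rng_src v) h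

theorem A_add_left {x x1 : X} {h : H} (r : Rel ra x h x1) (m m' : Mf x) (b : Bf h) :
    A DE r (m + m') b = A DE r m b + A DE r m' b := by
  apply A_ext (DE := DE) h r.unit1
  intro n
  rw [I_add_right, I_A1, I_A1, I_A1, I_add_right, add_Mu]
theorem A_smul_left {x x1 : X} {h : H} (r : Rel ra x h x1) (c : ℂ) (m : Mf x) (b : Bf h) :
    A DE r (c • m) b = c • A DE r m b := by
  apply A_ext (DE := DE) h r.unit1
  intro n
  rw [I_smul_right, I_A1, I_A1, I_smul_right, smul_Mu]
theorem A_add_right {x x1 : X} {h : H} (r : Rel ra x h x1) (m : Mf x) (b b' : Bf h) :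
    A DE r m (b + b') = A DE r m b + A DE r m b' := by
  apply A_ext (DE := DE) h r.unit1
  intro n
  rw [I_add_right, I_A1, I_A1, I_A1, Mu_add]
theorem A_smul_right {x x1 : X} {h : H} (r : Rel ra x h x1) (c : ℂ) (m : Mf x) (b : Bf h) :
    A DE r m (c • b) = c • A DE r m b := by
  apply A_ext (DE := DE) h r.unit1
  intro n
  rw [I_smul_right, I_A1, I_A1, Mu_smul]

theorem A_A {x x1 x2 : X} {h k l : H} (r1 : Rel ra x h x1) (r2 : Rel ra x1 k x2)
    (m : MRel 𝒢 h k l) (r3 : Rel ra x l x2) (p : Mf x) (b : Bf h) (c : Bf k) :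
    A DE r2 (A DE r1 p b) c = A DE r3 p (Mu FB m b c) := by
  apply A_ext (DE := DE) k r2.unit1
  intro n
  have m1 : MRel 𝒢 (𝒢.inv l) h (𝒢.inv k) := by
    have := m.inv.inv_right
    rwa [inv_inv] at this
  have m2 : MRel 𝒢 (𝒢.inv l) l (𝒢.src k) := by
    rw [← m.src]
    exact mrel_inv_mul l
  rw [I_A1, I_A r3.inv r1 m1 r2.inv, I_A r3.inv r3 m2, Mu_assoc m1 m (mrel_inv_mul k) m2]

theorem norm_A {x x1 : X} {h : H} (r : Rel ra x h x1) (m : Mf x) (b : Bf h) :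
    ‖A DE r m b‖ ≤ ‖m‖ * ‖b‖ := by
  have m1 : MRel 𝒢 (𝒢.inv h) (𝒢.rng h) (𝒢.inv h) := mul_src_of (𝒢.src_inv h)
  refine le_of_sq_le_sq ?_ (by positivity)
  rw [norm_sq (DE := DE) r.unit1 (𝒢.rng_src h), I_A1,
    A_I r rfl r.unit0 r.inv m1]
  refine (norm_Mu _ _ _).trans ?_
  have := norm_Mu (FB := FB) m1 (St FB rfl b) (I DE r.unit0 m m)
  rw [norm_St, ← norm_sq r.unit0 (𝒢.rng_rng h)] at this
  nlinarith [norm_nonneg b]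

theorem CS {x : X} {u : H} (r : Rel ra x u x) (hu : 𝒢.rng u = u) (m n : Mf x) :
    ‖I DE r m n‖ ≤ ‖m‖ * ‖n‖ := by
  let := unitAlg FB hu
  let := CStarAlgebra.spectralOrder (Bf u)
  let := CStarAlgebra.spectralOrderedRing (Bf u)
  let : SMul (Bf u) (Mf x) := ⟨fun b m => A DE r m b⟩
  let : CStarModule (Bf u) (Mf x) :=
    { inner := fun m n => I DE r m n
      inner_add_right := I_add_right _ _ _ _
      inner_self_nonneg := fun {m} => by
        obtain ⟨a, ha⟩ := I_pos (DE := DE) r hu m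
        rw [ha]
        exact mul_star_self_nonneg a
      inner_self := fun {m} => ⟨I_def r hu m, fun h => by
        subst h
        simpa using I_smul_right (DE := DE) r 0 (0 : Mf x) 0⟩
      inner_op_smul_right := I_A _ _ _ _ _ _ _
      inner_smul_right_complex := I_smul_right _ _ _ _
      star_inner := fun m n => St_I _ _ _ _ _
      norm_eq_sqrt_norm_inner_self := fun m => norm_eq_sqrt r hu m }
  exact CStarModule.norm_inner_le (A := Bf u) (Mf x)

theorem approx {x : X} {u : H} (r : Rel ra x u x) (hu : 𝒢.rng u = u) (w : Mf x) :
    w ∈ closure (Set.range fun e : Bf u => A DE r w e) := by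
  let := unitAlg FB hu
  let := CStarAlgebra.spectralOrder (Bf u)
  let := CStarAlgebra.spectralOrderedRing (Bf u)
  have hl := CStarAlgebra.increasingApproximateUnit (Bf u)
  set a : Bf u := I DE r w w with ha
  have hA : ∀ e : Bf u, star e = e → ‖e‖ ≤ 1 → ‖A DE r w e - w‖ ^ 2 ≤ 2 * ‖e * a - a‖ := by
    intro e he he1
    rw [norm_sq (DE := DE) r hu]
    have h1 : I DE r (A DE r w e - w) (A DE r w e - w) = (e * a - a) * e - (e * a - a) := by
      rw [I_sub_left, I_sub_right, I_sub_right, I_A r r (unit_mul hu) r,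
        I_A r r (unit_mul hu) r, A_I r (unit_inv hu) r r (unit_mul hu)]
      have e1 : St FB (unit_inv hu) e = e := he
      rw [e1, sub_mul]
      change (e * (a * e)) - a * e - (e * a - a) = _
      rw [mul_assoc]
    rw [h1]
    refine (norm_sub_le _ _).trans ?_
    have := norm_mul_le (e * a - a) e
    nlinarith [norm_nonneg (e * a - a)]
  have h2 : Filter.Tendsto (fun e : Bf u => 2 * ‖e * a - a‖) (CStarAlgebra.approximateUnit (Bf u))
      (nhds 0) := by
    have := (((hl.tendsto_mul_right a).sub_const a).norm).const_mul 2
    simpa using this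
  have h3 : Filter.Tendsto (fun e : Bf u => ‖A DE r w e - w‖ ^ 2)
      (CStarAlgebra.approximateUnit (Bf u)) (nhds 0) := by
    refine squeeze_zero' (Filter.Eventually.of_forall fun e => by positivity) ?_ h2
    filter_upwards [hl.eventually_star_eq, hl.eventually_norm] with e h4 h5
    exact hA e h4 h5
  have h4 : Filter.Tendsto (fun e : Bf u => ‖A DE r w e - w‖)
      (CStarAlgebra.approximateUnit (Bf u)) (nhds 0) := by
    have := h3.sqrt
    simpa [Real.sqrt_sq] using this
  have h5 := tendsto_iff_norm_sub_tendsto_zero.2 h4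
  exact mem_closure_of_tendsto h5 (Filter.Eventually.of_forall fun e => ⟨e, rfl⟩)

/-- The action as a continuous linear map in the algebra variable. -/
noncomputable def AL (DE : DemiEquiv FB ra Mf) {x x1 : X} {h : H} (r : Rel ra x h x1) (m : Mf x) :
    Bf h →L[ℂ] Mf x1 :=
  LinearMap.mkContinuous ⟨⟨fun b => A DE r m b, A_add_right r m⟩, fun c b => A_smul_right r c m b⟩
    ‖m‖ (norm_A r m)

/-- The action as a continuous linear map in the module variable. -/
noncomputable def AR (DE : DemiEquiv FB ra Mf) {x x1 : X} {h : H} (r : Rel ra x h x1) (b : Bf h) :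
    Mf x →L[ℂ] Mf x1 :=
  LinearMap.mkContinuous ⟨⟨fun m => A DE r m b, fun m m' => A_add_left r m m' b⟩,
    fun c m => A_smul_left r c m b⟩ ‖b‖ (fun m => (norm_A r m b).trans_eq (mul_comm _ _))

/-- The unit inner product as a continuous linear map. -/
noncomputable def IL (DE : DemiEquiv FB ra Mf) {x : X} {u : H} (r : Rel ra x u x)
    (hu : 𝒢.rng u = u) (m : Mf x) : Mf x →L[ℂ] Bf u :=
  LinearMap.mkContinuous ⟨⟨fun n => I DE r m n, I_add_right r m⟩, fun c b => I_smul_right r c m b⟩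
    ‖m‖ (CS r hu m)

@[simp] theorem AL_apply {x x1 : X} {h : H} (r : Rel ra x h x1) (m : Mf x) (b : Bf h) :
    AL DE r m b = A DE r m b := rfl
@[simp] theorem AR_apply {x x1 : X} {h : H} (r : Rel ra x h x1) (m : Mf x) (b : Bf h) :
    AR DE r b m = A DE r m b := rfl
@[simp] theorem IL_apply {x : X} {u : H} (r : Rel ra x u x)
    (hu : 𝒢.rng u = u) (m n : Mf x) : IL DE r hu m n = I DE r m n := rfl

/-- Elements `m ⊳ b` densely span `M(x·h)`. -/
theorem A_dense (DE : DemiEquiv FB ra Mf) {x x1 : X} {h : H} (r : Rel ra x h x1) :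
    Dense ((Submodule.span ℂ {w : Mf x1 | ∃ m b, w = A DE r m b} : Submodule ℂ (Mf x1)) :
      Set (Mf x1)) := by
  set N := Submodule.span ℂ {w : Mf x1 | ∃ m b, w = A DE r m b} with hN
  intro w
  have hcl : IsClosed (closure (N : Set (Mf x1))) := isClosed_closure
  have h1 := approx (DE := DE) r.unit1 (𝒢.rng_src h) w
  refine closure_minimal ?_ hcl h1
  rintro _ ⟨e, rfl⟩
  have h2 := Mu_dense (FB := FB) (mrel_inv_mul h) e
  have h3 : Continuous (AL DE r.unit1 w) := (AL DE r.unit1 w).continuous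
  refine map_mem_closure h3 h2 ?_
  intro e he
  induction he using Submodule.span_induction with
  | mem e he =>
    obtain ⟨a, b, rfl⟩ := he
    apply Submodule.subset_span
    exact ⟨A DE r.inv w a, b, (A_A _ _ _ _ _ _ _).symm⟩
  | zero => rw [← AL_apply, map_zero]; exact N.zero_mem
  | add a b _ _ ha hb => rw [← AL_apply, map_add]; exact N.add_mem ha hb
  | smul c a _ ha => rw [← AL_apply, map_smul]; exact N.smul_mem c ha

theorem A_clm_ext {x x1 : X} {h : H} (r : Rel ra x h x1) {V : Type*} [NormedAddCommGroup V]
    [NormedSpace ℂ V] {f g : Mf x1 →L[ℂ] V} (hfg : ∀ m b, f (A DE r m b) = g (A DE r m b)) :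
    f = g := by
  refine ContinuousLinearMap.ext_on (A_dense DE r) ?_
  rintro _ ⟨m, b, rfl⟩
  exact hfg m b

end mod

end PsiAux


namespace PsiAux

theorem log_convex_bound (a : ℕ → ℝ) (ha : ∀ k, 0 ≤ a k) (hc : ∀ k, a (k+1) ^ 2 ≤ a k * a (k+2))
    (C q : ℝ) (hq : 0 ≤ q) (hb : ∀ k, a k ≤ C * q ^ k) : a 1 ≤ q * a 0 := by
  by_contra! hcon
  have h0 : 0 < a 0 := by
    rcases (ha 0).lt_or_eq with h | h
    · exact h
    · have := hc 0
      rw [← h] at this hcon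
      simp at this hcon
      rw [this] at hcon
      exact absurd hcon (lt_irrefl _)
  set ρ := a 1 / a 0 with hρ
  have hqρ : q < ρ := by rw [hρ, lt_div_iff₀ h0]; exact hcon
  have hρ0 : 0 < ρ := hq.trans_lt hqρ
  have h1 : ∀ k, 0 < a k ∧ ρ * a k ≤ a (k+1) := by
    intro k
    induction k with
    | zero => exact ⟨h0, by rw [hρ, div_mul_cancel₀ _ h0.ne']⟩
    | succ k ih =>
      obtain ⟨i1, i2⟩ := ih
      have h3 : 0 < a (k+1) := lt_of_lt_of_le (by positivity) i2
      refine ⟨h3, ?_⟩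
      have h4 := hc k
      have h5 : a k * (ρ * a (k+1)) ≤ a k * a (k+2) := by
        nlinarith
      exact le_of_mul_le_mul_left h5 i1
  have h2 : ∀ k, ρ ^ k * a 0 ≤ a k := by
    intro k
    induction k with
    | zero => simp
    | succ k ih =>
      refine le_trans ?_ (h1 k).2
      rw [pow_succ]
      nlinarith
  have h3 : ∀ k, a 0 ≤ C * (q / ρ) ^ k := by
    intro k
    rw [div_pow, ← mul_div_assoc, le_div_iff₀ (by positivity), mul_comm]
    exact (h2 k).trans (hb k)
  have h4 : Filter.Tendsto (fun k => C * (q / ρ) ^ k) Filter.atTop (nhds (C * 0)) :=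
    (tendsto_pow_atTop_nhds_zero_of_lt_one (by positivity)
      ((div_lt_one hρ0).2 hqρ)).const_mul C
  have h5 := ge_of_tendsto' h4 h3
  simp at h5
  linarith

section mod
variable {H : Type*} [TopologicalSpace H] {𝒢 : TopGroupoid H}
  {Bf : H → Type*} [∀ g, NormedAddCommGroup (Bf g)] [∀ g, NormedSpace ℂ (Bf g)]
  [∀ g, CompleteSpace (Bf g)] [TopologicalSpace (Σ g, Bf g)]
  {FB : FellBundle 𝒢 Bf}
  {X : Type*} [TopologicalSpace X] {ra : RightGroupoidAction 𝒢 X}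
  {Mf : X → Type*} [∀ x, NormedAddCommGroup (Mf x)] [∀ x, NormedSpace ℂ (Mf x)]
  [∀ x, CompleteSpace (Mf x)] [TopologicalSpace (Σ x, Mf x)]
  {DE : DemiEquiv FB ra Mf}

theorem adj_bound {x y : X} {u : H} (rx : Rel ra x u x) (ry : Rel ra y u y) (hu : 𝒢.rng u = u)
    {T : Mf y →L[ℂ] Mf x} {T' : Mf x →L[ℂ] Mf y}
    (hT : ∀ z p, I DE rx (T z) p = I DE ry z (T' p)) (z : Mf y) :
    ‖T z‖ ^ 2 ≤ ‖z‖ * ‖T' (T z)‖ := by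
  rw [norm_sq (DE := DE) rx hu, hT]
  exact CS _ hu _ _

theorem adj_symm {x y : X} {u : H} (rx : Rel ra x u x) (ry : Rel ra y u y) (hu : 𝒢.rng u = u)
    {T : Mf y →L[ℂ] Mf x} {T' : Mf x →L[ℂ] Mf y}
    (hT : ∀ z p, I DE rx (T z) p = I DE ry z (T' p)) (p : Mf x) (z : Mf y) :
    I DE ry (T' p) z = I DE rx p (T z) := by
  rw [← St_I ry (unit_inv hu) ry, ← hT, St_I rx (unit_inv hu) rx]

theorem adj_norm {x y : X} {u : H} (rx : Rel ra x u x) (ry : Rel ra y u y) (hu : 𝒢.rng u = u)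
    {T : Mf y →L[ℂ] Mf x} {T' : Mf x →L[ℂ] Mf y}
    (hT : ∀ z p, I DE rx (T z) p = I DE ry z (T' p)) : ‖T‖ ≤ ‖T'‖ := by
  refine T.opNorm_le_bound (norm_nonneg _) fun z => ?_
  have h1 := adj_bound rx ry hu hT z
  have h2 := T'.le_opNorm (T z)
  rcases (norm_nonneg (T z)).eq_or_lt with h | h
  · rw [← h]; positivity
  · have h3 : ‖T z‖ * ‖T z‖ ≤ (‖T'‖ * ‖z‖) * ‖T z‖ := by nlinarith [norm_nonneg z]
    exact le_of_mul_le_mul_right h3 h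

theorem core {x y x1 y1 : X} {u v k : H} (rx : Rel ra x u x) (ry : Rel ra y u y)
    (hu : 𝒢.rng u = u) (rx1 : Rel ra x1 v x1) (ry1 : Rel ra y1 v y1) (hv : 𝒢.rng v = v)
    (r : Rel ra x k x1) (s : Rel ra y k y1)
    {T : Mf y →L[ℂ] Mf x} {T' : Mf x →L[ℂ] Mf y} {S : Mf y1 →L[ℂ] Mf x1} {S' : Mf x1 →L[ℂ] Mf y1}
    (hT : ∀ z p, I DE rx (T z) p = I DE ry z (T' p))
    (hS : ∀ z p, I DE rx1 (S z) p = I DE ry1 z (S' p))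
    (h1 : ∀ z c, S (A DE s z c) = A DE r (T z) c)
    (h2 : ∀ p c, S' (A DE r p c) = A DE s (T' p) c) : ‖S‖ ≤ ‖T‖ := by
  have hT' : ‖T'‖ ≤ ‖T‖ := adj_norm ry rx hu (adj_symm rx ry hu hT)
  set q := ‖T‖ ^ 2 with hq
  set A0 := T'.comp T with hA0
  set A1 := S'.comp S with hA1
  have hA0b : ∀ z, ‖A0 z‖ ≤ q * ‖z‖ := by
    intro z
    have i1 := T'.le_opNorm (T z)
    have i2 := T.le_opNorm z
    have i3 : ‖T'‖ * ‖T z‖ ≤ ‖T‖ * (‖T‖ * ‖z‖) := by gcongr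
    calc ‖A0 z‖ ≤ ‖T'‖ * ‖T z‖ := i1
      _ ≤ _ := i3
      _ = _ := by rw [hq]; ring
  have hA0k : ∀ k z, ‖(A0^[k]) z‖ ≤ q ^ k * ‖z‖ := by
    intro k z
    induction k with
    | zero => simp
    | succ k ih =>
      rw [Function.iterate_succ_apply', pow_succ']
      refine (hA0b _).trans ?_
      rw [mul_assoc]
      gcongr
  have hA1A : ∀ k z c, (A1^[k]) (A DE s z c) = A DE s ((A0^[k]) z) c := by
    intro k z c
    induction k with
    | zero => rfl
    | succ k ih =>
      rw [Function.iterate_succ_apply', Function.iterate_succ_apply', ih]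
      simp [hA1, hA0, h1, h2]
  have hbd : ∀ w ∈ Submodule.span ℂ {w : Mf y1 | ∃ m b, w = A DE s m b},
      ∃ C, ∀ k, ‖(A1^[k]) w‖ ≤ C * q ^ k := by
    intro w hw
    induction hw using Submodule.span_induction with
    | mem w hw =>
      obtain ⟨z, c, rfl⟩ := hw
      refine ⟨‖z‖ * ‖c‖, fun k => ?_⟩
      rw [hA1A]
      refine (norm_A _ _ _).trans ?_
      have := hA0k k z
      calc _ ≤ (q ^ k * ‖z‖) * ‖c‖ := by gcongr
        _ = _ := by ring
    | zero => exact ⟨0, fun k => by rw [iterate_map_zero]; simp⟩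
    | add a b _ _ ha hb =>
      obtain ⟨C, hC⟩ := ha
      obtain ⟨D, hD⟩ := hb
      refine ⟨C + D, fun k => ?_⟩
      rw [iterate_map_add, add_mul]
      exact (norm_add_le _ _).trans (add_le_add (hC k) (hD k))
    | smul c a _ ha =>
      obtain ⟨C, hC⟩ := ha
      refine ⟨‖c‖ * C, fun k => ?_⟩
      have hsm : (A1^[k]) (c • a) = c • (A1^[k]) a := by
        clear hC
        induction k with
        | zero => rfl
        | succ k ih => rw [Function.iterate_succ_apply', Function.iterate_succ_apply', ih, map_smul]
      rw [hsm, norm_smul, mul_assoc]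
      exact mul_le_mul_of_nonneg_left (hC k) (norm_nonneg _)
  have hconv : ∀ w, ‖A1 w‖ ^ 2 ≤ ‖w‖ * ‖A1 (A1 w)‖ := by
    intro w
    refine adj_bound (DE := DE) ry1 ry1 hv (T := A1) (T' := A1) ?_ w
    intro z p
    simp only [hA1, ContinuousLinearMap.comp_apply]
    rw [adj_symm rx1 ry1 hv hS, hS]
  have hmain : ∀ w ∈ Submodule.span ℂ {w : Mf y1 | ∃ m b, w = A DE s m b},
      ‖S w‖ ≤ ‖T‖ * ‖w‖ := by
    intro w hw
    obtain ⟨C, hC⟩ := hbd w hw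
    have i1 : ‖A1 w‖ ≤ q * ‖w‖ := by
      have := log_convex_bound (fun k => ‖(A1^[k]) w‖) (fun k => norm_nonneg _) (fun k => by
        simp only [Function.iterate_succ_apply']
        exact hconv _) C q (by positivity) hC
      simpa using this
    have i2 := adj_bound rx1 ry1 hv hS w
    refine le_of_sq_le_sq ?_ (by positivity)
    refine i2.trans ?_
    change ‖w‖ * ‖A1 w‖ ≤ _
    nlinarith [norm_nonneg w]
  refine S.opNorm_le_bound (norm_nonneg _) fun w => ?_
  have hcl : IsClosed {w | ‖S w‖ ≤ ‖T‖ * ‖w‖} := isClosed_le (by fun_prop) (by fun_prop)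
  exact closure_minimal hmain hcl (A_dense DE s w)

/-- Finite-rank operators. -/
noncomputable def theta (DE : DemiEquiv FB ra Mf) {x y : X} {u : H} (rx : Rel ra x u x)
    (ry : Rel ra y u y) (hu : 𝒢.rng u = u) {ι : Type*} [Fintype ι] (p : ι → Mf x) (n : ι → Mf y) :
    Mf y →L[ℂ] Mf x := ∑ i, (AL DE rx (p i)).comp (IL DE ry hu (n i))

theorem theta_apply {x y : X} {u : H} (rx : Rel ra x u x)
    (ry : Rel ra y u y) (hu : 𝒢.rng u = u) {ι : Type*} [Fintype ι] (p : ι → Mf x) (n : ι → Mf y)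
    (z : Mf y) : theta DE rx ry hu p n z = ∑ i, A DE rx (p i) (I DE ry (n i) z) := by
  simp [theta]

theorem I_sum_left {x x1 : X} {h : H} (r : Rel ra x h x1) {ι : Type*} (s : Finset ι)
    (f : ι → Mf x) (n : Mf x1) :
    I DE r (∑ i ∈ s, f i) n = ∑ i ∈ s, I DE r (f i) n :=
  map_sum (⟨⟨fun m => I DE r m n, by
    simpa using I_sub_left (DE := DE) r 0 0 n⟩, fun a b => I_add_left r a b n⟩ : Mf x →+ Bf h) f s

theorem I_sum_right {x x1 : X} {h : H} (r : Rel ra x h x1) {ι : Type*} (s : Finset ι)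
    (f : ι → Mf x1) (n : Mf x) :
    I DE r n (∑ i ∈ s, f i) = ∑ i ∈ s, I DE r n (f i) :=
  map_sum (⟨⟨fun m => I DE r n m, by
    simpa using I_sub_right (DE := DE) r n 0 0⟩, fun a b => I_add_right r n a b⟩ : Mf x1 →+ Bf h) f s

theorem theta_adj {x y : X} {u : H} (rx : Rel ra x u x)
    (ry : Rel ra y u y) (hu : 𝒢.rng u = u) {ι : Type*} [Fintype ι] (p : ι → Mf x) (n : ι → Mf y)
    (z : Mf y) (q : Mf x) :
    I DE rx (theta DE rx ry hu p n z) q = I DE ry z (theta DE ry rx hu n p q) := by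
  rw [theta_apply, theta_apply, I_sum_left, I_sum_right]
  refine Finset.sum_congr rfl fun i _ => ?_
  rw [A_I rx (unit_inv hu) rx rx (unit_mul hu), I_A ry ry (unit_mul hu) ry,
    St_I ry (unit_inv hu) ry]

theorem A_sum_left {x x1 : X} {h : H} (r : Rel ra x h x1) {ι : Type*} (s : Finset ι)
    (f : ι → Mf x) (b : Bf h) :
    A DE r (∑ i ∈ s, f i) b = ∑ i ∈ s, A DE r (f i) b := by
  exact map_sum (AR DE r b) f s

/-- Intertwining: `θ_{m, n⊳b*} (z ⊳ c) = θ_{m⊳b, n}(z) ⊳ c`. -/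
theorem theta_inter {x y x1 y1 : X} {u v h h' : H} (hh : 𝒢.inv h = h')
    (rx : Rel ra x u x) (ry1 : Rel ra y1 u y1)
    (hu : 𝒢.rng u = u) (rx1 : Rel ra x1 v x1) (ry : Rel ra y v y) (hv : 𝒢.rng v = v)
    (r : Rel ra x h x1) (s : Rel ra y h' y1) (r' : Rel ra x1 h' x)
    {ι : Type*} [Fintype ι] (m : ι → Mf x) (b : ι → Bf h) (n : ι → Mf y)
    (z : Mf y) (c : Bf h') :
    theta DE rx ry1 hu m (fun i => A DE s (n i) (St FB hh (b i))) (A DE s z c)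
      = A DE r' (theta DE rx1 ry hv (fun i => A DE r (m i) (b i)) n z) c := by
  have hh' : 𝒢.inv h' = h := by rw [← hh, inv_inv]
  have eu : 𝒢.rng h = u := by rw [← r.1]; exact unit_eq rx hu
  have ev : 𝒢.src h = v := by rw [← r.anchor1]; exact unit_eq rx1 hv
  have m1 : MRel 𝒢 h v h := mul_src_of ev
  have m2 : MRel 𝒢 h h' u := by subst hh eu; exact mrel_mul_inv h
  have m3 : MRel 𝒢 v h' h' := rng_mul_of (by rw [← hh, 𝒢.rng_inv, ev])
  rw [theta_apply, theta_apply, A_sum_left]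
  refine Finset.sum_congr rfl fun i _ => ?_
  rw [A_A r rx1 m1 r, A_A r r' m2 rx, A_I s hh' s ry1 m2, St_St, I_A ry s m3 s,
    Mu_assoc m1 m3 m2 m2]

/-- Intertwining: `θ_{m⊳b, n} (w ⊳ d) = θ_{m, n⊳b*}(w) ⊳ d`. -/
theorem theta_inter' {x y x1 y1 : X} {u v h h' : H} (hh : 𝒢.inv h = h')
    (rx : Rel ra x u x) (ry1 : Rel ra y1 u y1)
    (hu : 𝒢.rng u = u) (rx1 : Rel ra x1 v x1) (ry : Rel ra y v y) (hv : 𝒢.rng v = v)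
    (r : Rel ra x h x1) (s : Rel ra y h' y1) (s' : Rel ra y1 h y)
    {ι : Type*} [Fintype ι] (m : ι → Mf x) (b : ι → Bf h) (n : ι → Mf y)
    (w : Mf y1) (d : Bf h) :
    theta DE rx1 ry hv (fun i => A DE r (m i) (b i)) n (A DE s' w d) =
    A DE r (theta DE rx ry1 hu m (fun i => A DE s (n i) (St FB hh (b i))) w) d := by
  have hh' : 𝒢.inv h' = h := by rw [← hh, inv_inv]
  have eu : 𝒢.rng h = u := by rw [← r.1]; exact unit_eq rx hu
  have ev : 𝒢.src h = v := by rw [← r.anchor1]; exact unit_eq rx1 hv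
  have m1 : MRel 𝒢 h v h := mul_src_of ev
  have m2 : MRel 𝒢 h h' u := by subst hh eu; exact mrel_mul_inv h
  have m3 : MRel 𝒢 h' h v := by subst hh ev; exact mrel_inv_mul h
  have m4 : MRel 𝒢 u h h := rng_mul_of eu
  rw [theta_apply, theta_apply, A_sum_left]
  refine Finset.sum_congr rfl fun i _ => ?_
  rw [A_A r rx1 m1 r, A_A rx r m4 r, A_I s hh' s ry1 m2, St_St, I_A s s' m3 ry,
    Mu_assoc m2 m3 m4 m1]

theorem theta_norm {x y x1 y1 : X} {u v h h' : H} (hh : 𝒢.inv h = h')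
    (rx : Rel ra x u x) (ry1 : Rel ra y1 u y1)
    (hu : 𝒢.rng u = u) (rx1 : Rel ra x1 v x1) (ry : Rel ra y v y) (hv : 𝒢.rng v = v)
    (r : Rel ra x h x1) (s : Rel ra y h' y1)
    {ι : Type*} [Fintype ι] (m : ι → Mf x) (b : ι → Bf h) (n : ι → Mf y) :
    ‖theta DE rx ry1 hu m (fun i => A DE s (n i) (St FB hh (b i)))‖ =
      ‖theta DE rx1 ry hv (fun i => A DE r (m i) (b i)) n‖ := by
  have hh' : 𝒢.inv h' = h := by rw [← hh, inv_inv]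
  have r' : Rel ra x1 h' x := by rw [← hh]; exact r.inv
  have s' : Rel ra y1 h y := by rw [← hh']; exact s.inv
  have eb : ∀ i, b i = St FB hh' (St FB hh (b i)) := fun i => (St_St _ _ _).symm
  apply le_antisymm
  · refine core (DE := DE) rx1 ry hv rx ry1 hu r' s (theta_adj _ _ _ _ _) (theta_adj _ _ _ _ _)
      (theta_inter hh rx ry1 hu rx1 ry hv r s r' m b n) ?_
    intro p c
    have := theta_inter' (DE := DE) hh' ry rx1 hv ry1 rx hu s r r' n (fun i => St FB hh (b i)) m p c
    simpa only [← eb] using this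
  · refine core (DE := DE) rx ry1 hu rx1 ry hv r s' (theta_adj _ _ _ _ _) (theta_adj _ _ _ _ _)
      (theta_inter' hh rx ry1 hu rx1 ry hv r s s' m b n) ?_
    intro p c
    have := theta_inter (DE := DE) hh' ry rx1 hv ry1 rx hu s r s' n (fun i => St FB hh (b i)) m p c
    simpa only [← eb] using this

end mod

end PsiAux


namespace PsiAux

section tens
variable {H : Type*} [TopologicalSpace H] {𝒢 : TopGroupoid H}
  {Bf : H → Type*} [∀ g, NormedAddCommGroup (Bf g)] [∀ g, NormedSpace ℂ (Bf g)]
  [∀ g, CompleteSpace (Bf g)] [TopologicalSpace (Σ g, Bf g)]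
  {FB : FellBundle 𝒢 Bf}
  {X : Type*} [TopologicalSpace X] {ra : RightGroupoidAction 𝒢 X}
  {Mf : X → Type*} [∀ x, NormedAddCommGroup (Mf x)] [∀ x, NormedSpace ℂ (Mf x)]
  [∀ x, CompleteSpace (Mf x)] [TopologicalSpace (Σ x, Mf x)]
  {DE : DemiEquiv FB ra Mf}

theorem cast_uinner {y : X} (n z : Mf y) {u : H} (e : ra.anchor y = u) (ry : Rel ra y u y) :
    cast (congrArg Bf e) (DE.uinner y n z) = I DE ry n z := by
  subst e; rfl

theorem cast_uact {y : X} (n : Mf y) {g u : H} (e : 𝒢.inv g = u) (e' : ra.anchor y = u)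
    (ry : Rel ra y u y) (e2 : 𝒢.inv g = ra.anchor y) (b : Bf g) :
    DE.uact y n (cast (congrArg Bf e2) (FB.star' b)) = A DE ry n (St FB e b) := by
  subst e'; rfl

theorem norm_t {x y : X} {hxy : ra.anchor x = ra.anchor y}
    {hinv : 𝒢.inv (ra.anchor x) = ra.anchor y} (P : FibreTensorPkg DE x y hxy hinv)
    {u : H} (rx : Rel ra x u x) (ry : Rel ra y u y) (hu : 𝒢.rng u = u)
    {ι : Type*} [Fintype ι] (m : ι → Mf x) (n : ι → Mf y) :
    ‖∑ i, P.R.t (m i) (n i)‖ = ‖theta DE rx ry hu m n‖ := by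
  obtain rfl := unit_eq rx hu
  have e := Fintype.equivFin ι
  rw [← e.symm.sum_comp, P.R.norm_eq _ (fun k => m (e.symm k)) (fun k => n (e.symm k)),
    ← (theta DE rx ry hu m n).sSup_unitClosedBall_eq_norm, sSup_image']
  have hs : ∀ z : Mf y, ‖z‖ ≤ 1 ↔ z ∈ Metric.closedBall (0 : Mf y) 1 := fun z => by simp
  refine Equiv.iSup_congr (Equiv.subtypeEquivRight hs) fun z => ?_
  rw [theta_apply, ← e.symm.sum_comp]
  simp only [cast_uinner _ _ hxy.symm ry]
  rfl

theorem norm_t_le {x y : X} {hxy : ra.anchor x = ra.anchor y}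
    {hinv : 𝒢.inv (ra.anchor x) = ra.anchor y} (P : FibreTensorPkg DE x y hxy hinv)
    (m : Mf x) (n : Mf y) : ‖P.R.t m n‖ ≤ ‖n‖ * ‖m‖ := by
  have h := norm_t P (relU x) (relU' hxy.symm) (ra.anchor_unit x) (fun _ : Unit => m) (fun _ => n)
  rw [Fintype.sum_unique] at h
  rw [h]
  refine ContinuousLinearMap.opNorm_le_bound _ (by positivity) fun z => ?_
  rw [theta_apply, Fintype.sum_unique]
  refine (norm_A _ _ _).trans ?_
  have := CS (DE := DE) (relU' hxy.symm) (ra.anchor_unit x) n z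
  calc _ ≤ ‖m‖ * (‖n‖ * ‖z‖) := by gcongr
    _ = _ := by ring

/-- The elementary tensor as a continuous linear map in the left variable. -/
noncomputable def tL {x y : X} {hxy : ra.anchor x = ra.anchor y}
    {hinv : 𝒢.inv (ra.anchor x) = ra.anchor y} (P : FibreTensorPkg DE x y hxy hinv)
    (n : Mf y) : Mf x →L[ℂ] P.T :=
  LinearMap.mkContinuous ⟨⟨fun m => P.R.t m n, fun m m' => P.R.add_left m m' n⟩,
    fun c m => P.R.smul_left c m n⟩ ‖n‖ (fun m => norm_t_le P m n)

@[simp] theorem tL_apply {x y : X} {hxy : ra.anchor x = ra.anchor y}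
    {hinv : 𝒢.inv (ra.anchor x) = ra.anchor y} (P : FibreTensorPkg DE x y hxy hinv)
    (n : Mf y) (m : Mf x) : tL P n m = P.R.t m n := rfl

theorem t_dense {x x1 y : X} {hxy : ra.anchor x1 = ra.anchor y}
    {hinv : 𝒢.inv (ra.anchor x1) = ra.anchor y} (P : FibreTensorPkg DE x1 y hxy hinv)
    {h : H} (r : Rel ra x h x1) :
    Dense ((Submodule.span ℂ (Set.range fun q : Mf x × Bf h × Mf y =>
      P.R.t (A DE r q.1 q.2.1) q.2.2) : Submodule ℂ P.T) : Set P.T) := by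
  set N := Submodule.span ℂ (Set.range fun q : Mf x × Bf h × Mf y =>
      P.R.t (A DE r q.1 q.2.1) q.2.2) with hN
  have h1 : ∀ n m, P.R.t m n ∈ N.topologicalClosure := by
    intro n m
    have hcl : IsClosed {w | tL P n w ∈ N.topologicalClosure} :=
      N.isClosed_topologicalClosure.preimage (tL P n).continuous
    refine closure_minimal ?_ hcl (A_dense DE r m)
    intro w hw
    change w ∈ N.topologicalClosure.comap (tL P n).toLinearMap
    refine (Submodule.span_le.2 ?_) hw
    rintro _ ⟨p, b, rfl⟩
    exact N.le_topologicalClosure (Submodule.subset_span ⟨(p, b, n), rfl⟩)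
  have h2 : Submodule.span ℂ {z : P.T | ∃ m n, z = P.R.t m n} ≤ N.topologicalClosure := by
    refine Submodule.span_le.2 ?_
    rintro _ ⟨m, n, rfl⟩
    exact h1 n m
  intro z
  exact closure_minimal h2 N.isClosed_topologicalClosure (P.R.dense_span z)

theorem t_clm_ext {x y : X} {hxy : ra.anchor x = ra.anchor y}
    {hinv : 𝒢.inv (ra.anchor x) = ra.anchor y} (P : FibreTensorPkg DE x y hxy hinv)
    {V : Type*} [NormedAddCommGroup V] [NormedSpace ℂ V] {f g : P.T →L[ℂ] V}
    (hfg : ∀ n, f.comp (tL P n) = g.comp (tL P n)) : f = g := by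
  refine ContinuousLinearMap.ext_on P.R.dense_span ?_
  rintro _ ⟨m, n, rfl⟩
  exact DFunLike.congr_fun (hfg n) m

/-- The defining property of `Ψ_h`. -/
def IsPsi {x x1 y y1 : X} {h h' : H} (hh : 𝒢.inv h = h') (r : Rel ra x h x1) (s : Rel ra y h' y1)
    {hxy : ra.anchor x1 = ra.anchor y} {hinv : 𝒢.inv (ra.anchor x1) = ra.anchor y}
    (P : FibreTensorPkg DE x1 y hxy hinv)
    {hxy2 : ra.anchor x = ra.anchor y1} {hinv2 : 𝒢.inv (ra.anchor x) = ra.anchor y1}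
    (Q : FibreTensorPkg DE x y1 hxy2 hinv2) (F : P.T →L[ℂ] Q.T) : Prop :=
  ∀ m b n, F (P.R.t (A DE r m b) n) = Q.R.t m (A DE s n (St FB hh b))

theorem psi_exists {x x1 y y1 : X} {h h' : H} (hh : 𝒢.inv h = h') (r : Rel ra x h x1)
    (s : Rel ra y h' y1)
    {hxy : ra.anchor x1 = ra.anchor y} {hinv : 𝒢.inv (ra.anchor x1) = ra.anchor y}
    (P : FibreTensorPkg DE x1 y hxy hinv)
    {hxy2 : ra.anchor x = ra.anchor y1} {hinv2 : 𝒢.inv (ra.anchor x) = ra.anchor y1}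
    (Q : FibreTensorPkg DE x y1 hxy2 hinv2) :
    ∃ F : P.T →L[ℂ] Q.T, IsPsi hh r s P Q F ∧ ∀ ξ, ‖F ξ‖ = ‖ξ‖ := by
  let e : (Mf x × Bf h × Mf y →₀ ℂ) →ₗ[ℂ] P.T :=
    Finsupp.linearCombination ℂ (fun q : Mf x × Bf h × Mf y => P.R.t (A DE r q.1 q.2.1) q.2.2)
  let f : (Mf x × Bf h × Mf y →₀ ℂ) →ₗ[ℂ] Q.T :=
    Finsupp.linearCombination ℂ
      (fun q : Mf x × Bf h × Mf y => Q.R.t q.1 (A DE s q.2.2 (St FB hh q.2.1)))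
  have hnorm : ∀ c, ‖f c‖ = ‖e c‖ := by
    intro c
    have he : e c = ∑ q : c.support,
        P.R.t (A DE r (c q.1 • q.1.1) q.1.2.1) q.1.2.2 := by
      simp only [e, Finsupp.linearCombination_apply, Finsupp.sum]
      rw [← Finset.sum_coe_sort]
      refine Finset.sum_congr rfl fun q _ => ?_
      rw [A_smul_left, P.R.smul_left]
    have hf : f c = ∑ q : c.support,
        Q.R.t (c q.1 • q.1.1) (A DE s q.1.2.2 (St FB hh q.1.2.1)) := by
      simp only [f, Finsupp.linearCombination_apply, Finsupp.sum]
      rw [← Finset.sum_coe_sort]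
      refine Finset.sum_congr rfl fun q _ => ?_
      rw [Q.R.smul_left]
    rw [he, hf, norm_t Q (relU x) (relU' hxy2.symm) (ra.anchor_unit x)
      (fun q : c.support => c q.1 • q.1.1) (fun q => A DE s q.1.2.2 (St FB hh q.1.2.1)),
      norm_t P (relU x1) (relU' hxy.symm) (ra.anchor_unit x1)
      (fun q : c.support => A DE r (c q.1 • q.1.1) q.1.2.1) (fun q => q.1.2.2)]
    exact theta_norm hh _ _ _ _ _ _ r s (fun q : c.support => c q.1 • q.1.1)
      (fun q => q.1.2.1) (fun q => q.1.2.2)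
  have hd : DenseRange e := by
    have := t_dense P r
    rw [← Finsupp.range_linearCombination] at this
    exact this
  have hC : ∃ C, ∀ c, ‖f c‖ ≤ C * ‖e c‖ := ⟨1, fun c => by rw [hnorm, one_mul]⟩
  have hF := LinearMap.extendOfNorm_eq (f := f) (e := e) hd hC
  refine ⟨f.extendOfNorm e, ?_, ?_⟩
  · intro m b n
    have := hF (Finsupp.single (m, b, n) 1)
    simpa [e, f] using this
  · intro ξ
    refine hd.induction_on (p := fun ξ => ‖f.extendOfNorm e ξ‖ = ‖ξ‖) ξ
      (isClosed_eq (by fun_prop) (by fun_prop)) fun c => ?_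
    rw [hF, hnorm]

theorem isPsi_comp {x x1 x2 y y1 y2 : X} {h k l h' k' l' : H} (hh : 𝒢.inv h = h')
    (hk : 𝒢.inv k = k') (hl : 𝒢.inv l = l') (mr : MRel 𝒢 k h l)
    (r1 : Rel ra x k x1) (r2 : Rel ra x1 h x2) (r3 : Rel ra x l x2)
    (s1 : Rel ra y h' y1) (s2 : Rel ra y1 k' y2) (s3 : Rel ra y l' y2)
    {hxy : ra.anchor x2 = ra.anchor y} {hinv : 𝒢.inv (ra.anchor x2) = ra.anchor y}
    {P : FibreTensorPkg DE x2 y hxy hinv}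
    {hxy2 : ra.anchor x1 = ra.anchor y1} {hinv2 : 𝒢.inv (ra.anchor x1) = ra.anchor y1}
    {Q : FibreTensorPkg DE x1 y1 hxy2 hinv2}
    {hxy3 : ra.anchor x = ra.anchor y2} {hinv3 : 𝒢.inv (ra.anchor x) = ra.anchor y2}
    {S : FibreTensorPkg DE x y2 hxy3 hinv3}
    {F : P.T →L[ℂ] Q.T} {G : Q.T →L[ℂ] S.T} {K : P.T →L[ℂ] S.T}
    (hF : IsPsi hh r2 s1 P Q F) (hG : IsPsi hk r1 s2 Q S G) (hK : IsPsi hl r3 s3 P S K) :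
    G.comp F = K := by
  have mr' : MRel 𝒢 h' k' l' := by subst hh hk hl; exact mr.inv
  refine t_clm_ext P fun n => A_clm_ext (DE := DE) r2 fun p b => ?_
  suffices ((G.comp F).comp (tL P n)).comp (AR DE r2 b) = (K.comp (tL P n)).comp (AR DE r2 b) from
    DFunLike.congr_fun this p
  refine A_clm_ext (DE := DE) r1 fun m c => ?_
  simp only [ContinuousLinearMap.comp_apply, AR_apply, tL_apply]
  rw [hF, hG, A_A r1 r2 mr r3, hK, A_A s1 s2 mr' s3, St_Mu mr hk hh hl mr']

theorem isPsi_id {x y : X} {u : H} (hu : ra.anchor x = u) (hh : 𝒢.inv u = u)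
    (r : Rel ra x u x) (s : Rel ra y u y)
    {hxy : ra.anchor x = ra.anchor y} {hinv : 𝒢.inv (ra.anchor x) = ra.anchor y}
    (P : FibreTensorPkg DE x y hxy hinv) :
    IsPsi hh r s P P (ContinuousLinearMap.id ℂ P.T) := by
  intro m b n
  subst hu
  have := P.R.balanced m n b
  rw [cast_uact n hh hxy.symm s hinv] at this
  exact this

theorem isPsi_id' {x y : X} {u u' : H} (hu : ra.anchor x = u) (hh : 𝒢.inv u = u')
    (r : Rel ra x u x) (s : Rel ra y u' y)
    {hxy : ra.anchor x = ra.anchor y} {hinv : 𝒢.inv (ra.anchor x) = ra.anchor y}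
    (P : FibreTensorPkg DE x y hxy hinv) :
    IsPsi hh r s P P (ContinuousLinearMap.id ℂ P.T) := by
  have e : u' = u := by rw [← hh, ← hu, hinv, hxy]
  subst e
  exact isPsi_id hu hh r s P

theorem isPsi_unique {x x1 y y1 : X} {h h' : H} {hh : 𝒢.inv h = h'} {r : Rel ra x h x1}
    {s : Rel ra y h' y1}
    {hxy : ra.anchor x1 = ra.anchor y} {hinv : 𝒢.inv (ra.anchor x1) = ra.anchor y}
    {P : FibreTensorPkg DE x1 y hxy hinv}
    {hxy2 : ra.anchor x = ra.anchor y1} {hinv2 : 𝒢.inv (ra.anchor x) = ra.anchor y1}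
    {Q : FibreTensorPkg DE x y1 hxy2 hinv2} {F G : P.T →L[ℂ] Q.T}
    (hF : IsPsi hh r s P Q F) (hG : IsPsi hh r s P Q G) : F = G := by
  refine t_clm_ext P fun n => A_clm_ext (DE := DE) r fun m b => ?_
  simp only [ContinuousLinearMap.comp_apply, tL_apply]
  rw [hF, hG]

variable (KK : ∀ (x y : X) (hxy : ra.anchor x = ra.anchor y)
      (hinv : 𝒢.inv (ra.anchor x) = ra.anchor y), FibreTensorPkg DE x y hxy hinv)

theorem comp_heq {x x1 x2 y y1 y2 x2' y2' : X} {h k l h' k' l' : H} (hh : 𝒢.inv h = h')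
    (hk : 𝒢.inv k = k') (hl : 𝒢.inv l = l') (mr : MRel 𝒢 k h l)
    (r1 : Rel ra x k x1) (r2 : Rel ra x1 h x2) (r3 : Rel ra x l x2')
    (s1 : Rel ra y h' y1) (s2 : Rel ra y1 k' y2) (s3 : Rel ra y l' y2')
    {hxy : ra.anchor x2 = ra.anchor y} {hinv : 𝒢.inv (ra.anchor x2) = ra.anchor y}
    {hxy2 : ra.anchor x1 = ra.anchor y1} {hinv2 : 𝒢.inv (ra.anchor x1) = ra.anchor y1}
    {hxy3 : ra.anchor x = ra.anchor y2} {hinv3 : 𝒢.inv (ra.anchor x) = ra.anchor y2}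
    {hxy4 : ra.anchor x2' = ra.anchor y} {hinv4 : 𝒢.inv (ra.anchor x2') = ra.anchor y}
    {hxy5 : ra.anchor x = ra.anchor y2'} {hinv5 : 𝒢.inv (ra.anchor x) = ra.anchor y2'}
    {F : (KK x2 y hxy hinv).T →L[ℂ] (KK x1 y1 hxy2 hinv2).T}
    {G : (KK x1 y1 hxy2 hinv2).T →L[ℂ] (KK x y2 hxy3 hinv3).T}
    {K : (KK x2' y hxy4 hinv4).T →L[ℂ] (KK x y2' hxy5 hinv5).T}
    (hF : IsPsi hh r2 s1 _ _ F) (hG : IsPsi hk r1 s2 _ _ G) (hK : IsPsi hl r3 s3 _ _ K)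
    (ξ : (KK x2 y hxy hinv).T) (ξ' : (KK x2' y hxy4 hinv4).T) (hξ : HEq ξ ξ') :
    HEq (G (F ξ)) (K ξ') := by
  have mr' : MRel 𝒢 h' k' l' := by subst hh hk hl; exact mr.inv
  have e1 : x2 = x2' := by
    obtain ⟨c, d⟩ := r1.mul r2 mr
    obtain ⟨c', d'⟩ := r3
    rw [← d, ← d']
  have e2 : y2 = y2' := by
    obtain ⟨c, d⟩ := s1.mul s2 mr'
    obtain ⟨c', d'⟩ := s3
    rw [← d, ← d']
  subst e1 e2
  obtain rfl := eq_of_heq hξ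
  rw [← isPsi_comp hh hk hl mr r1 r2 r3 s1 s2 s3 hF hG hK]
  rfl

theorem inv_heq {x x1 y y1 x' y' : X} {h h' h'' : H} (hh : 𝒢.inv h = h') (hh' : 𝒢.inv h' = h'')
    (r : Rel ra x h x1) (s : Rel ra y h' y1) (r' : Rel ra x1 h' x') (s' : Rel ra y1 h'' y')
    {hxy : ra.anchor x1 = ra.anchor y} {hinv : 𝒢.inv (ra.anchor x1) = ra.anchor y}
    {hxy2 : ra.anchor x = ra.anchor y1} {hinv2 : 𝒢.inv (ra.anchor x) = ra.anchor y1}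
    {hxy3 : ra.anchor x' = ra.anchor y1} {hinv3 : 𝒢.inv (ra.anchor x') = ra.anchor y1}
    {hxy4 : ra.anchor x1 = ra.anchor y'} {hinv4 : 𝒢.inv (ra.anchor x1) = ra.anchor y'}
    {F : (KK x1 y hxy hinv).T →L[ℂ] (KK x y1 hxy2 hinv2).T}
    {G : (KK x' y1 hxy3 hinv3).T →L[ℂ] (KK x1 y' hxy4 hinv4).T}
    (hF : IsPsi hh r s _ _ F) (hG : IsPsi hh' r' s' _ _ G)
    (ξ : (KK x1 y hxy hinv).T) (η : (KK x' y1 hxy3 hinv3).T) (hη : HEq (F ξ) η) :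
    HEq (G η) ξ := by
  have e1 : x' = x := by
    obtain ⟨c, d⟩ := r.inv
    obtain ⟨c', d'⟩ := r'
    subst hh
    rw [← d, ← d']
  have e2 : y' = y := by
    obtain ⟨c, d⟩ := s.inv
    obtain ⟨c', d'⟩ := s'
    subst hh'
    rw [← d, ← d']
  subst e1 e2
  obtain rfl := eq_of_heq hη
  have mr : MRel 𝒢 h' h (𝒢.src h) := by subst hh; exact mrel_inv_mul h
  have hi : 𝒢.inv (𝒢.src h) = 𝒢.src h := unit_inv (𝒢.rng_src h)
  have s0 : Rel ra y' (𝒢.src h) y' := relU' (hxy.symm.trans r.anchor1)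
  have := isPsi_comp hh hh' hi mr r' r r.unit1 s s' s0 hF hG
    (isPsi_id r.anchor1 hi r.unit1 s0 _)
  exact heq_of_eq (DFunLike.congr_fun this ξ)

theorem unit_heq {x x1 y y1 : X} {u u' : H} (hu : ra.anchor x = u) (hh : 𝒢.inv u = u')
    (r : Rel ra x u x1) (s : Rel ra y u' y1)
    {hxy : ra.anchor x1 = ra.anchor y} {hinv : 𝒢.inv (ra.anchor x1) = ra.anchor y}
    {hxy2 : ra.anchor x = ra.anchor y1} {hinv2 : 𝒢.inv (ra.anchor x) = ra.anchor y1}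
    {F : (KK x1 y hxy hinv).T →L[ℂ] (KK x y1 hxy2 hinv2).T}
    (hF : IsPsi hh r s _ _ F) (ξ : (KK x1 y hxy hinv).T) : HEq (F ξ) ξ := by
  have e1 : x1 = x := by
    obtain ⟨c', d'⟩ := r
    subst hu
    rw [← d', ra.act_unit]
  subst e1
  have hu' : u' = ra.anchor y := by rw [← hh, ← hu, hinv]
  have e2 : y1 = y := by
    obtain ⟨c', d'⟩ := s
    subst hu'
    rw [← d', ra.act_unit]
  subst e2
  have := isPsi_unique hF (isPsi_id' hu hh r s _)
  rw [this]
  rfl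

end tens

end PsiAux

/-- **Lemma 3.3** (`lem:Psi_h`). -/
theorem demiEquiv_Psi_exists
    {H : Type*} [TopologicalSpace H] [LocallyCompactSpace H] [T2Space H]
    {X : Type*} [TopologicalSpace X] [LocallyCompactSpace X] [T2Space X]
    {𝒢 : TopGroupoid H} (hsrc : 𝒢.OpenSource)
    {Bf : H → Type*} [∀ g, NormedAddCommGroup (Bf g)] [∀ g, NormedSpace ℂ (Bf g)]
    [∀ g, CompleteSpace (Bf g)] [TopologicalSpace (Σ g, Bf g)]
    {FB : FellBundle 𝒢 Bf}
    {ra : RightGroupoidAction 𝒢 X} (hprin : ra.IsPrincipal)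
    (hopen : ra.OpenAnchor) (hsurj : ra.SurjAnchor)
    {Mf : X → Type*} [∀ x, NormedAddCommGroup (Mf x)] [∀ x, NormedSpace ℂ (Mf x)]
    [∀ x, CompleteSpace (Mf x)] [TopologicalSpace (Σ x, Mf x)]
    (DE : DemiEquiv FB ra Mf)
    -- a family of realizations of the fibre tensor products M(x) ⊗ M(y)^op
    (KK : ∀ (x y : X) (hxy : ra.anchor x = ra.anchor y)
      (hinv : 𝒢.inv (ra.anchor x) = ra.anchor y), FibreTensorPkg DE x y hxy hinv) :
    ∃ Ψ : ∀ (x y : X) (h : H) (hcx : ra.anchor x = 𝒢.rng h)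
      (hcy : ra.anchor y = 𝒢.rng (𝒢.inv h))
      (hxy₁ : ra.anchor (ra.act x h hcx) = ra.anchor y)
      (hinv₁ : 𝒢.inv (ra.anchor (ra.act x h hcx)) = ra.anchor y)
      (hxy₂ : ra.anchor x = ra.anchor (ra.act y (𝒢.inv h) hcy))
      (hinv₂ : 𝒢.inv (ra.anchor x) = ra.anchor (ra.act y (𝒢.inv h) hcy)),
      (KK (ra.act x h hcx) y hxy₁ hinv₁).T → (KK x (ra.act y (𝒢.inv h) hcy) hxy₂ hinv₂).T,
      -- (Ψ1) each Ψ_h is linear (on each fibre of the disjoint union)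
      (∀ x y h hcx hcy hxy₁ hinv₁ hxy₂ hinv₂,
        IsLinearMap ℂ (Ψ x y h hcx hcy hxy₁ hinv₁ hxy₂ hinv₂)) ∧
      -- Ψ_h is determined by (m ⊳ b) ⊗ n^op ↦ m ⊗ (n ⊳ b*)^op
      (∀ x y h hcx hcy hxy₁ hinv₁ hxy₂ hinv₂ (m : Mf x) (b : Bf h) (n : Mf y),
        Ψ x y h hcx hcy hxy₁ hinv₁ hxy₂ hinv₂
            ((KK (ra.act x h hcx) y hxy₁ hinv₁).R.t (DE.ract x h hcx m b) n)
          = (KK x (ra.act y (𝒢.inv h) hcy) hxy₂ hinv₂).R.t m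
              (DE.ract y (𝒢.inv h) hcy n (FB.star' b))) ∧
      -- (Ψ2) each Ψ_h is isometric
      (∀ x y h hcx hcy hxy₁ hinv₁ hxy₂ hinv₂ ξ,
        ‖Ψ x y h hcx hcy hxy₁ hinv₁ hxy₂ hinv₂ ξ‖ = ‖ξ‖) ∧
      -- (Ψ3) Ψ_{h'} ∘ Ψ_h = Ψ_{h'h} for composable (h', h)
      (∀ (x' y : X) (h' h : H) (hcomp : 𝒢.src h' = 𝒢.rng h)
        (hcx' : ra.anchor x' = 𝒢.rng h')
        (hcx : ra.anchor (ra.act x' h' hcx') = 𝒢.rng h)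
        (hcy : ra.anchor y = 𝒢.rng (𝒢.inv h))
        (hcy'' : ra.anchor (ra.act y (𝒢.inv h) hcy) = 𝒢.rng (𝒢.inv h'))
        (hxy₁ : ra.anchor (ra.act (ra.act x' h' hcx') h hcx) = ra.anchor y)
        (hinv₁ : 𝒢.inv (ra.anchor (ra.act (ra.act x' h' hcx') h hcx)) = ra.anchor y)
        (hxy₂ : ra.anchor (ra.act x' h' hcx') = ra.anchor (ra.act y (𝒢.inv h) hcy))
        (hinv₂ : 𝒢.inv (ra.anchor (ra.act x' h' hcx')) = ra.anchor (ra.act y (𝒢.inv h) hcy))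
        (hxy₅ : ra.anchor x'
          = ra.anchor (ra.act (ra.act y (𝒢.inv h) hcy) (𝒢.inv h') hcy''))
        (hinv₅ : 𝒢.inv (ra.anchor x')
          = ra.anchor (ra.act (ra.act y (𝒢.inv h) hcy) (𝒢.inv h') hcy''))
        (hcmul : ra.anchor x' = 𝒢.rng (𝒢.mul h' h hcomp))
        (hcymul : ra.anchor y = 𝒢.rng (𝒢.inv (𝒢.mul h' h hcomp)))
        (hxy₆ : ra.anchor (ra.act x' (𝒢.mul h' h hcomp) hcmul) = ra.anchor y)
        (hinv₆ : 𝒢.inv (ra.anchor (ra.act x' (𝒢.mul h' h hcomp) hcmul)) = ra.anchor y)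
        (hxy₇ : ra.anchor x'
          = ra.anchor (ra.act y (𝒢.inv (𝒢.mul h' h hcomp)) hcymul))
        (hinv₇ : 𝒢.inv (ra.anchor x')
          = ra.anchor (ra.act y (𝒢.inv (𝒢.mul h' h hcomp)) hcymul))
        (ξ : (KK (ra.act (ra.act x' h' hcx') h hcx) y hxy₁ hinv₁).T)
        (ξ' : (KK (ra.act x' (𝒢.mul h' h hcomp) hcmul) y hxy₆ hinv₆).T),
        HEq ξ ξ' →
        HEq (Ψ x' (ra.act y (𝒢.inv h) hcy) h' hcx' hcy'' hxy₂ hinv₂ hxy₅ hinv₅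
              (Ψ (ra.act x' h' hcx') y h hcx hcy hxy₁ hinv₁ hxy₂ hinv₂ ξ))
            (Ψ x' y (𝒢.mul h' h hcomp) hcmul hcymul hxy₆ hinv₆ hxy₇ hinv₇ ξ')) ∧
      -- (Ψ4) Ψ_{h⁻¹} is inverse to Ψ_h
      (∀ (x y : X) (h : H) (hcx : ra.anchor x = 𝒢.rng h)
        (hcy : ra.anchor y = 𝒢.rng (𝒢.inv h))
        (hxy₁ : ra.anchor (ra.act x h hcx) = ra.anchor y)
        (hinv₁ : 𝒢.inv (ra.anchor (ra.act x h hcx)) = ra.anchor y)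
        (hxy₂ : ra.anchor x = ra.anchor (ra.act y (𝒢.inv h) hcy))
        (hinv₂ : 𝒢.inv (ra.anchor x) = ra.anchor (ra.act y (𝒢.inv h) hcy))
        (hcx₀ : ra.anchor (ra.act x h hcx) = 𝒢.rng (𝒢.inv h))
        (hcy₀ : ra.anchor (ra.act y (𝒢.inv h) hcy) = 𝒢.rng (𝒢.inv (𝒢.inv h)))
        (hxy₃ : ra.anchor (ra.act (ra.act x h hcx) (𝒢.inv h) hcx₀)
          = ra.anchor (ra.act y (𝒢.inv h) hcy))
        (hinv₃ : 𝒢.inv (ra.anchor (ra.act (ra.act x h hcx) (𝒢.inv h) hcx₀))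
          = ra.anchor (ra.act y (𝒢.inv h) hcy))
        (hxy₄ : ra.anchor (ra.act x h hcx)
          = ra.anchor (ra.act (ra.act y (𝒢.inv h) hcy) (𝒢.inv (𝒢.inv h)) hcy₀))
        (hinv₄ : 𝒢.inv (ra.anchor (ra.act x h hcx))
          = ra.anchor (ra.act (ra.act y (𝒢.inv h) hcy) (𝒢.inv (𝒢.inv h)) hcy₀))
        (ξ : (KK (ra.act x h hcx) y hxy₁ hinv₁).T)
        (η : (KK (ra.act (ra.act x h hcx) (𝒢.inv h) hcx₀)
          (ra.act y (𝒢.inv h) hcy) hxy₃ hinv₃).T),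
        HEq (Ψ x y h hcx hcy hxy₁ hinv₁ hxy₂ hinv₂ ξ) η →
        HEq (Ψ (ra.act x h hcx) (ra.act y (𝒢.inv h) hcy) (𝒢.inv h)
              hcx₀ hcy₀ hxy₃ hinv₃ hxy₄ hinv₄ η) ξ) ∧
      -- (Ψ5) Ψ_u is the identity for units u
      (∀ (x y : X) (hcx : ra.anchor x = 𝒢.rng (ra.anchor x))
        (hcy : ra.anchor y = 𝒢.rng (𝒢.inv (ra.anchor x)))
        (hxy₁ : ra.anchor (ra.act x (ra.anchor x) hcx) = ra.anchor y)
        (hinv₁ : 𝒢.inv (ra.anchor (ra.act x (ra.anchor x) hcx)) = ra.anchor y)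
        (hxy₂ : ra.anchor x = ra.anchor (ra.act y (𝒢.inv (ra.anchor x)) hcy))
        (hinv₂ : 𝒢.inv (ra.anchor x) = ra.anchor (ra.act y (𝒢.inv (ra.anchor x)) hcy))
        (ξ : (KK (ra.act x (ra.anchor x) hcx) y hxy₁ hinv₁).T),
        HEq (Ψ x y (ra.anchor x) hcx hcy hxy₁ hinv₁ hxy₂ hinv₂ ξ) ξ) := by
  classical
  have hex := fun (x y : X) (h : H) (hcx : ra.anchor x = 𝒢.rng h)
      (hcy : ra.anchor y = 𝒢.rng (𝒢.inv h))
      (hxy₁ : ra.anchor (ra.act x h hcx) = ra.anchor y)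
      (hinv₁ : 𝒢.inv (ra.anchor (ra.act x h hcx)) = ra.anchor y)
      (hxy₂ : ra.anchor x = ra.anchor (ra.act y (𝒢.inv h) hcy))
      (hinv₂ : 𝒢.inv (ra.anchor x) = ra.anchor (ra.act y (𝒢.inv h) hcy)) =>
    PsiAux.psi_exists (DE := DE) rfl (⟨hcx, rfl⟩ : PsiAux.Rel ra x h (ra.act x h hcx))
      (⟨hcy, rfl⟩ : PsiAux.Rel ra y (𝒢.inv h) (ra.act y (𝒢.inv h) hcy))
      (KK (ra.act x h hcx) y hxy₁ hinv₁) (KK x (ra.act y (𝒢.inv h) hcy) hxy₂ hinv₂)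
  choose F hF hN using hex
  refine ⟨fun x y h hcx hcy hxy₁ hinv₁ hxy₂ hinv₂ ξ => F x y h hcx hcy hxy₁ hinv₁ hxy₂ hinv₂ ξ,
    ?_, ?_, ?_, ?_, ?_, ?_⟩
  · intro x y h hcx hcy hxy₁ hinv₁ hxy₂ hinv₂
    exact ⟨fun a b => map_add _ a b, fun c a => map_smul _ c a⟩
  · intro x y h hcx hcy hxy₁ hinv₁ hxy₂ hinv₂ m b n
    exact hF x y h hcx hcy hxy₁ hinv₁ hxy₂ hinv₂ m b n
  · intro x y h hcx hcy hxy₁ hinv₁ hxy₂ hinv₂ ξ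
    exact hN x y h hcx hcy hxy₁ hinv₁ hxy₂ hinv₂ ξ
  · intro x' y h' h hcomp hcx' hcx hcy hcy'' hxy₁ hinv₁ hxy₂ hinv₂ hxy₅ hinv₅ hcmul hcymul
      hxy₆ hinv₆ hxy₇ hinv₇ ξ ξ' hξ
    exact PsiAux.comp_heq KK rfl rfl rfl ⟨hcomp, rfl⟩ _ _ _ _ _ _
      (hF (ra.act x' h' hcx') y h hcx hcy hxy₁ hinv₁ hxy₂ hinv₂)
      (hF x' (ra.act y (𝒢.inv h) hcy) h' hcx' hcy'' hxy₂ hinv₂ hxy₅ hinv₅)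
      (hF x' y (𝒢.mul h' h hcomp) hcmul hcymul hxy₆ hinv₆ hxy₇ hinv₇) ξ ξ' hξ
  · intro x y h hcx hcy hxy₁ hinv₁ hxy₂ hinv₂ hcx₀ hcy₀ hxy₃ hinv₃ hxy₄ hinv₄ ξ η hη
    exact PsiAux.inv_heq KK rfl rfl _ _ _ _
      (hF x y h hcx hcy hxy₁ hinv₁ hxy₂ hinv₂)
      (hF (ra.act x h hcx) (ra.act y (𝒢.inv h) hcy) (𝒢.inv h) hcx₀ hcy₀ hxy₃ hinv₃ hxy₄ hinv₄)
      ξ η hη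
  · intro x y hcx hcy hxy₁ hinv₁ hxy₂ hinv₂ ξ
    exact PsiAux.unit_heq KK rfl rfl _ _
      (hF x y (ra.anchor x) hcx hcy hxy₁ hinv₁ hxy₂ hinv₂) ξ
end

section
/- Let B be a Fell bundle over a groupoid H and M a right B-demi-equivalence. For x,y ∈ X with σ(x)=σ(y)=u, there is a continuous bilinear map Φ : (M(x) ⊗_{B(u)} M(y)^op) × M(y) → M(x) determined on elementary tensors by Φ(m ⊗ n^op, k) = m ⊳ ⟨n,k⟩_B, and it satisfies ‖Φ(ξ,k)‖ ≤ ‖ξ‖·‖k‖ for all ξ and k. -/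
section Aux

theorem aux_norm_heq {I : Type*} {E : I → Type*} [∀ i, NormedAddCommGroup (E i)] {i j : I}
    (h : i = j) {a : E i} {b : E j} (hab : HEq a b) : ‖a‖ = ‖b‖ := by
  subst h; rw [eq_of_heq hab]

theorem aux_cast_add {I : Type*} {E : I → Type*} [∀ i, NormedAddCommGroup (E i)] {i j : I}
    (h : i = j) (a b : E i) :
    cast (congrArg E h) (a + b) = cast (congrArg E h) a + cast (congrArg E h) b := by
  subst h; rfl

theorem aux_cast_smul {I : Type*} {E : I → Type*} [∀ i, NormedAddCommGroup (E i)]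
    [∀ i, NormedSpace ℂ (E i)] {i j : I}
    (h : i = j) (c : ℂ) (a : E i) :
    cast (congrArg E h) (c • a) = c • cast (congrArg E h) a := by
  subst h; rfl

theorem aux_norm_cast {I : Type*} {E : I → Type*} [∀ i, NormedAddCommGroup (E i)] {i j : I}
    (h : i = j) (a : E i) : ‖cast (congrArg E h) a‖ = ‖a‖ := by
  subst h; rfl

variable {H : Type*} [TopologicalSpace H] {𝒢 : TopGroupoid H}
  {Bf : H → Type*} [∀ g, NormedAddCommGroup (Bf g)] [∀ g, NormedSpace ℂ (Bf g)]
  [∀ g, CompleteSpace (Bf g)] [TopologicalSpace (Σ g, Bf g)]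
  {FB : FellBundle 𝒢 Bf}
  {X : Type*} [TopologicalSpace X] {ra : RightGroupoidAction 𝒢 X}
  {Mf : X → Type*} [∀ x, NormedAddCommGroup (Mf x)] [∀ x, NormedSpace ℂ (Mf x)]
  [∀ x, CompleteSpace (Mf x)] [TopologicalSpace (Σ x, Mf x)]

namespace DemiEquiv

theorem uinner_add_left (DE : DemiEquiv FB ra Mf) (x : X) (m m' n : Mf x) :
    DE.uinner x (m + m') n = DE.uinner x m n + DE.uinner x m' n :=
  DE.inner_add_left _ _ _ _ _ _

theorem uinner_smul_left (DE : DemiEquiv FB ra Mf) (x : X) (c : ℂ) (m n : Mf x) :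
    DE.uinner x (c • m) n = (starRingEnd ℂ c) • DE.uinner x m n :=
  DE.inner_smul_left _ _ _ _ _ _

theorem uinner_add_right (DE : DemiEquiv FB ra Mf) (x : X) (m n n' : Mf x) :
    DE.uinner x m (n + n') = DE.uinner x m n + DE.uinner x m n' := by
  unfold uinner
  rw [aux_cast_add (ra.act_unit x (ra.anchor_unit x).symm).symm, DE.inner_add_right]

theorem uinner_smul_right (DE : DemiEquiv FB ra Mf) (x : X) (c : ℂ) (m n : Mf x) :
    DE.uinner x m (c • n) = c • DE.uinner x m n := by
  unfold uinner
  rw [aux_cast_smul (ra.act_unit x (ra.anchor_unit x).symm).symm, DE.inner_smul_right]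

theorem uinner_def (DE : DemiEquiv FB ra Mf) (x : X) (m : Mf x) (h : DE.uinner x m m = 0) :
    m = 0 :=
  DE.inner_self_eq_zero x (ra.anchor_unit x).symm m h

theorem norm_sq_eq (DE : DemiEquiv FB ra Mf) (x : X) (m : Mf x) :
    ‖m‖ ^ 2 = ‖DE.uinner x m m‖ := by
  rw [DE.norm_eq x (ra.anchor_unit x).symm m, Real.sq_sqrt (norm_nonneg _)]
  rfl

theorem inner_heq (DE : DemiEquiv FB ra Mf) {x x' : X} (hx : x = x') {h h' : H} (hh : h = h')
    (hc : ra.anchor x = 𝒢.rng h) (hc' : ra.anchor x' = 𝒢.rng h')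
    {m : Mf x} {m' : Mf x'} (hm : HEq m m')
    {n : Mf (ra.act x h hc)} {n' : Mf (ra.act x' h' hc')} (hn : HEq n n') :
    HEq (DE.inner x h hc m n) (DE.inner x' h' hc' m' n') := by
  subst hx; subst hh
  rw [eq_of_heq hm, eq_of_heq hn]

theorem ract_heq (DE : DemiEquiv FB ra Mf) {x x' : X} (hx : x = x') {h : H}
    (hc : ra.anchor x = 𝒢.rng h) (hc' : ra.anchor x' = 𝒢.rng h)
    {m : Mf x} {m' : Mf x'} (hm : HEq m m') (b : Bf h) :
    HEq (DE.ract x h hc m b) (DE.ract x' h hc' m' b) := by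
  subst hx
  rw [eq_of_heq hm]

theorem src_anchor (ra : RightGroupoidAction 𝒢 X) (x : X) :
    𝒢.src (ra.anchor x) = ra.anchor x := by
  have h := 𝒢.src_rng (ra.anchor x)
  rwa [ra.anchor_unit x] at h

theorem src_rng_anchor (ra : RightGroupoidAction 𝒢 X) (x : X) :
    𝒢.src (ra.anchor x) = 𝒢.rng (ra.anchor x) :=
  (src_anchor ra x).trans (ra.anchor_unit x).symm

theorem mul_anchor (ra : RightGroupoidAction 𝒢 X) (x : X) :
    𝒢.mul (ra.anchor x) (ra.anchor x) (src_rng_anchor ra x) = ra.anchor x := by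
  have h : ∀ g (hg : 𝒢.src (ra.anchor x) = 𝒢.rng g), g = 𝒢.src (ra.anchor x) →
      𝒢.mul (ra.anchor x) g hg = ra.anchor x := by
    intro g hg e; subst e; exact 𝒢.mul_src _ _
  exact h _ _ (src_anchor ra x).symm

theorem uinner_uact (DE : DemiEquiv FB ra Mf) (x : X) (a m : Mf x) (b : Bf (ra.anchor x)) :
    DE.uinner x a (DE.uact x m b) =
      cast (congrArg Bf (mul_anchor ra x))
        (FB.mul (src_rng_anchor ra x) (DE.uinner x a m) b) := by
  have hc := (ra.anchor_unit x).symm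
  have hx := ra.act_unit x hc
  have hc₂ : ra.anchor (ra.act x (ra.anchor x) hc) = 𝒢.rng (ra.anchor x) := by
    rw [hx]; exact hc
  have hcm : ra.anchor x = 𝒢.rng (𝒢.mul (ra.anchor x) (ra.anchor x) (src_rng_anchor ra x)) := by
    rw [mul_anchor]; exact hc
  have key := DE.inner_ract x (ra.anchor x) (ra.anchor x) hc (src_rng_anchor ra x) hc₂ hcm
    (ra.act_mul _ _ _ _ _ _ _) a (cast (congrArg Mf hx.symm) m) b
  apply eq_of_heq
  refine HEq.trans ?_ (cast_heq _ _).symm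
  unfold uinner
  rw [← key]
  refine DE.inner_heq rfl (mul_anchor ra x).symm _ _ HEq.rfl ?_
  refine (cast_heq _ _).trans (HEq.trans ?_ (cast_heq _ _).symm)
  unfold uact
  refine (cast_heq _ _).trans ?_
  exact DE.ract_heq hx.symm _ _ (cast_heq _ _).symm b

theorem inv_anchor (ra : RightGroupoidAction 𝒢 X) (x : X) :
    𝒢.inv (ra.anchor x) = ra.anchor x := by
  have h1 : 𝒢.src (𝒢.inv (ra.anchor x)) = 𝒢.rng (ra.anchor x) := 𝒢.src_inv _
  have h2 := 𝒢.inv_mul (ra.anchor x) h1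
  have h : ∀ g (hg : 𝒢.src (𝒢.inv (ra.anchor x)) = 𝒢.rng g), g = 𝒢.src (𝒢.inv (ra.anchor x)) →
      𝒢.mul (𝒢.inv (ra.anchor x)) g hg = 𝒢.inv (ra.anchor x) := by
    intro g hg e; subst e; exact 𝒢.mul_src _ _
  rw [← h _ h1 (by rw [h1, ra.anchor_unit]), h2, src_anchor]

theorem norm_uinner_comm (DE : DemiEquiv FB ra Mf) (x : X) (m n : Mf x) :
    ‖DE.uinner x m n‖ = ‖DE.uinner x n m‖ := by
  have hc := (ra.anchor_unit x).symm
  have hx := ra.act_unit x hc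
  have hc' : ra.anchor (ra.act x (ra.anchor x) hc) = 𝒢.rng (𝒢.inv (ra.anchor x)) := by
    rw [hx, inv_anchor]; exact hc
  have hgen : ∀ (x' : X) (h' : H) (hcc : ra.anchor x' = 𝒢.rng h'), x' = x → h' = ra.anchor x →
      ra.act x' h' hcc = x := by
    intro x' h' hcc e1 e2; subst e1; subst e2; exact ra.act_unit _ _
  have hback := hgen _ _ hc' hx (inv_anchor ra x)
  have key := DE.inner_star x (ra.anchor x) hc hc' hback m (cast (congrArg Mf hx.symm) n)
  have h1 : ‖DE.uinner x m n‖ = ‖FB.star' (DE.uinner x m n)‖ := (FB.norm_star _).symm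
  rw [h1]
  unfold uinner
  rw [key]
  refine aux_norm_heq (inv_anchor ra x) ?_
  exact DE.inner_heq hx (inv_anchor ra x) _ _ (cast_heq _ _)
    ((cast_heq _ _).trans (cast_heq _ _).symm)

theorem norm_uact_le (DE : DemiEquiv FB ra Mf) (x : X) (m : Mf x) (b : Bf (ra.anchor x)) :
    ‖DE.uact x m b‖ ≤ ‖m‖ * ‖b‖ := by
  have h1 : ∀ a : Mf x, ‖DE.uinner x a (DE.uact x m b)‖ ≤ ‖DE.uinner x a m‖ * ‖b‖ := by
    intro a
    rw [uinner_uact, aux_norm_cast (mul_anchor ra x)]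
    exact FB.norm_mul_le _ _ _
  have h2 := h1 (DE.uact x m b)
  rw [← norm_sq_eq, norm_uinner_comm] at h2
  have h3 := h1 m
  rw [← norm_sq_eq] at h3
  have h4 : ‖DE.uact x m b‖ ^ 2 ≤ (‖m‖ * ‖b‖) ^ 2 := by
    calc _ ≤ _ := h2
      _ ≤ (‖m‖ ^ 2 * ‖b‖) * ‖b‖ := by gcongr
      _ = _ := by ring
  exact le_of_sq_le_sq h4 (by positivity)

theorem ext_uinner (DE : DemiEquiv FB ra Mf) (x : X) (m n : Mf x)
    (h : ∀ a, DE.uinner x a m = DE.uinner x a n) : m = n := by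
  have h0 : m + (-1 : ℂ) • n = 0 := by
    apply DE.uinner_def
    rw [uinner_add_right, uinner_smul_right, h]
    simp
  have : m - n = 0 := by rw [← h0]; simp [sub_eq_add_neg]
  exact sub_eq_zero.mp this

theorem uact_add (DE : DemiEquiv FB ra Mf) (x : X) (m : Mf x) (b b' : Bf (ra.anchor x)) :
    DE.uact x m (b + b') = DE.uact x m b + DE.uact x m b' := by
  apply DE.ext_uinner
  intro a
  rw [uinner_add_right, uinner_uact, uinner_uact, uinner_uact, FB.mul_add,
    aux_cast_add (mul_anchor ra x)]

theorem uact_smul (DE : DemiEquiv FB ra Mf) (x : X) (m : Mf x) (c : ℂ) (b : Bf (ra.anchor x)) :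
    DE.uact x m (c • b) = c • DE.uact x m b := by
  apply DE.ext_uinner
  intro a
  rw [uinner_smul_right, uinner_uact, uinner_uact, FB.mul_smul',
    aux_cast_smul (mul_anchor ra x)]

/-- The map `k ↦ ⟨n, k⟩` as a linear map. -/
noncomputable def uinnerL (DE : DemiEquiv FB ra Mf) (y : X) (n : Mf y) :
    Mf y →ₗ[ℂ] Bf (ra.anchor y) where
  toFun := DE.uinner y n
  map_add' := DE.uinner_add_right y n
  map_smul' c k := DE.uinner_smul_right y c n k

theorem uinnerL_continuous (DE : DemiEquiv FB ra Mf) (y : X) (n : Mf y) :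
    Continuous (DE.uinnerL y n) := by
  apply continuous_of_continuousAt_zero
  have hc := (ra.anchor_unit y).symm
  have hx := ra.act_unit y hc
  let q : Mf y → {q : (Σ x, Mf x) × H × (Σ x, Mf x) //
        ∃ hc : ra.anchor q.1.1 = 𝒢.rng q.2.1, q.2.2.1 = ra.act q.1.1 q.2.1 hc} :=
    fun z => ⟨(⟨y, n⟩, ra.anchor y, ⟨y, z⟩), hc, hx.symm⟩
  have hz : Filter.Tendsto (fun z : Mf y => (⟨y, z⟩ : Σ x, Mf x)) (nhds 0) (nhds ⟨y, 0⟩) := by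
    apply DE.bundle.zero_criterion
    · rw [Filter.tendsto_map'_iff]
      exact tendsto_norm_zero
    · rw [Filter.tendsto_map'_iff]
      exact tendsto_const_nhds
  have hq : Filter.Tendsto q (nhds 0) (nhds (q 0)) := by
    rw [tendsto_subtype_rng]
    exact tendsto_const_nhds.prodMk_nhds (tendsto_const_nhds.prodMk_nhds hz)
  have hi := (DE.inner_continuous.tendsto (q 0)).comp hq
  have hi' : Filter.Tendsto
      (fun z : Mf y => (⟨ra.anchor y, DE.uinner y n z⟩ : Σ g, Bf g)) (nhds 0)
      (nhds ⟨ra.anchor y, DE.uinner y n 0⟩) := hi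
  have h0 : DE.uinner y n 0 = 0 := (DE.uinnerL y n).map_zero
  unfold ContinuousAt
  rw [LinearMap.map_zero, Metric.tendsto_nhds]
  intro ε hε
  have hu := FB.bundle.usc_norm ⟨ra.anchor y, DE.uinner y n 0⟩ ε (by simpa [h0] using hε)
  filter_upwards [hi'.eventually hu] with z hz
  rw [dist_zero_right]
  exact hz

/-- The rank-one operator `k ↦ m ⊳ ⟨n, k⟩`. -/
noncomputable def rankOne (DE : DemiEquiv FB ra Mf) (x y : X)
    (hxy : ra.anchor x = ra.anchor y) (m : Mf x) (n : Mf y) : Mf y →L[ℂ] Mf x :=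
  (LinearMap.mkContinuous
    { toFun := fun b => DE.uact x m (cast (congrArg Bf hxy.symm) b)
      map_add' := fun b b' => by rw [aux_cast_add hxy.symm, uact_add]
      map_smul' := fun c b => by rw [aux_cast_smul hxy.symm, uact_smul]; rfl }
    ‖m‖ (fun b => by
      refine (DE.norm_uact_le x m _).trans ?_
      rw [aux_norm_cast hxy.symm])).comp ⟨DE.uinnerL y n, DE.uinnerL_continuous y n⟩

theorem rankOne_apply (DE : DemiEquiv FB ra Mf) (x y : X)
    (hxy : ra.anchor x = ra.anchor y) (m : Mf x) (n k : Mf y) :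
    DE.rankOne x y hxy m n k
      = DE.uact x m (cast (congrArg Bf hxy.symm) (DE.uinner y n k)) := rfl

theorem rankOne_smul (DE : DemiEquiv FB ra Mf) (x y : X)
    (hxy : ra.anchor x = ra.anchor y) (c : ℂ) (m : Mf x) (n : Mf y) :
    DE.rankOne x y hxy m (starRingEnd ℂ c • n) = c • DE.rankOne x y hxy m n := by
  ext k
  rw [ContinuousLinearMap.smul_apply, rankOne_apply, rankOne_apply, uinner_smul_left,
    aux_cast_smul hxy.symm, uact_smul, Complex.conj_conj]

end DemiEquiv

theorem FibreTensor.norm_sum_le {DE : DemiEquiv FB ra Mf} {x y : X}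
    {hxy : ra.anchor x = ra.anchor y} {hinv : 𝒢.inv (ra.anchor x) = ra.anchor y}
    {T : Type*} [NormedAddCommGroup T] [NormedSpace ℂ T] [CompleteSpace T]
    (R : FibreTensor DE x y hxy hinv T) (k : ℕ) (m : Fin k → Mf x) (n : Fin k → Mf y) :
    ‖∑ i, DE.rankOne x y hxy (m i) (n i)‖ ≤ ‖∑ i, R.t (m i) (n i)‖ := by
  set A := ∑ i, DE.rankOne x y hxy (m i) (n i) with hA
  have happ : ∀ z, A z =
      ∑ i, DE.uact x (m i) (cast (congrArg Bf hxy.symm) (DE.uinner y (n i) z)) := by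
    intro z
    rw [hA, ContinuousLinearMap.sum_apply]
    rfl
  have hbdd : BddAbove (Set.range fun z : {z : Mf y // ‖z‖ ≤ 1} => ‖A z.1‖) := by
    refine ⟨‖A‖, ?_⟩
    rintro _ ⟨z, rfl⟩
    refine (A.le_opNorm z.1).trans ?_
    exact mul_le_of_le_one_right (norm_nonneg _) z.2
  rw [R.norm_eq]
  simp only [← happ]
  refine ContinuousLinearMap.opNorm_le_of_unit_norm (𝕜 := ℂ)
    (Real.iSup_nonneg fun z => norm_nonneg _) ?_
  intro z hz
  exact le_ciSup hbdd ⟨z, hz.le⟩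

theorem FibreTensor.exists_clm {DE : DemiEquiv FB ra Mf} {x y : X}
    {hxy : ra.anchor x = ra.anchor y} {hinv : 𝒢.inv (ra.anchor x) = ra.anchor y}
    {T : Type*} [NormedAddCommGroup T] [NormedSpace ℂ T] [CompleteSpace T]
    (R : FibreTensor DE x y hxy hinv T) :
    ∃ F : T →L[ℂ] (Mf y →L[ℂ] Mf x),
      (∀ m n, F (R.t m n) = DE.rankOne x y hxy m n) ∧ ∀ ξ, ‖F ξ‖ ≤ ‖ξ‖ := by
  let τ : (Mf x × Mf y →₀ ℂ) →ₗ[ℂ] T := Finsupp.linearCombination ℂ fun p => R.t p.1 p.2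
  let θ : (Mf x × Mf y →₀ ℂ) →ₗ[ℂ] (Mf y →L[ℂ] Mf x) :=
    Finsupp.linearCombination ℂ fun p => DE.rankOne x y hxy p.1 p.2
  have hτ : DenseRange τ := by
    have h := R.dense_span
    have h2 : {z : T | ∃ m n, z = R.t m n} = Set.range fun p : Mf x × Mf y => R.t p.1 p.2 := by
      ext z
      constructor
      · rintro ⟨m, n, rfl⟩; exact ⟨(m, n), rfl⟩
      · rintro ⟨p, rfl⟩; exact ⟨p.1, p.2, rfl⟩
    rw [h2, ← Finsupp.range_linearCombination] at h
    exact h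
  have hle : ∀ p, ‖θ p‖ ≤ 1 * ‖τ p‖ := by
    intro p
    rw [one_mul]
    let e := p.support.equivFin.symm
    have h1 : τ p = ∑ i, R.t (e i).1.1 (starRingEnd ℂ (p (e i).1) • (e i).1.2) := by
      simp only [R.conj_smul_right, Complex.conj_conj]
      rw [Equiv.sum_comp e (fun s => p s.1 • R.t s.1.1 s.1.2),
        Finset.sum_coe_sort p.support (fun s => p s • R.t s.1 s.2)]
      rfl
    have h2 : θ p = ∑ i, DE.rankOne x y hxy (e i).1.1
        (starRingEnd ℂ (p (e i).1) • (e i).1.2) := by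
      simp only [DE.rankOne_smul]
      rw [Equiv.sum_comp e (fun s => p s.1 • DE.rankOne x y hxy s.1.1 s.1.2),
        Finset.sum_coe_sort p.support (fun s => p s • DE.rankOne x y hxy s.1 s.2)]
      rfl
    rw [h1, h2]
    exact R.norm_sum_le _ _ _
  refine ⟨θ.extendOfNorm τ, ?_, ?_⟩
  · intro m n
    have h := LinearMap.extendOfNorm_eq hτ ⟨1, hle⟩ (Finsupp.single (m, n) 1)
    simpa [τ, θ] using h
  · intro ξ
    have h := LinearMap.norm_extendOfNorm_apply_le hτ 1 hle ξ
    simpa using h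

end Aux

/-- **Lemma 3.5** (`lem:left action on fibres`). -/
theorem demiEquiv_fibre_action_exists
    {H : Type*} [TopologicalSpace H] [LocallyCompactSpace H] [T2Space H]
    {X : Type*} [TopologicalSpace X] [LocallyCompactSpace X] [T2Space X]
    {𝒢 : TopGroupoid H} (hsrc : 𝒢.OpenSource)
    {Bf : H → Type*} [∀ g, NormedAddCommGroup (Bf g)] [∀ g, NormedSpace ℂ (Bf g)]
    [∀ g, CompleteSpace (Bf g)] [TopologicalSpace (Σ g, Bf g)]
    {FB : FellBundle 𝒢 Bf}
    {ra : RightGroupoidAction 𝒢 X} (hprin : ra.IsPrincipal)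
    (hopen : ra.OpenAnchor) (hsurj : ra.SurjAnchor)
    {Mf : X → Type*} [∀ x, NormedAddCommGroup (Mf x)] [∀ x, NormedSpace ℂ (Mf x)]
    [∀ x, CompleteSpace (Mf x)] [TopologicalSpace (Σ x, Mf x)]
    (DE : DemiEquiv FB ra Mf) (x y : X)
    (hxy : ra.anchor x = ra.anchor y) (hinv : 𝒢.inv (ra.anchor x) = ra.anchor y)
    (K : FibreTensorPkg DE x y hxy hinv) :
    ∃ Φ : K.T → Mf y → Mf x,
      -- bilinearity
      (∀ ξ ξ' k, Φ (ξ + ξ') k = Φ ξ k + Φ ξ' k) ∧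
      (∀ (c : ℂ) ξ k, Φ (c • ξ) k = c • Φ ξ k) ∧
      (∀ ξ k k', Φ ξ (k + k') = Φ ξ k + Φ ξ k') ∧
      (∀ (c : ℂ) ξ k, Φ ξ (c • k) = c • Φ ξ k) ∧
      -- joint continuity
      Continuous (fun p : K.T × Mf y => Φ p.1 p.2) ∧
      -- determined on elementary tensors by Φ(m ⊗ n^op, k) = m ⊳ ⟨n, k⟩_B
      (∀ (m : Mf x) (n : Mf y) (k : Mf y),
        Φ (K.R.t m n) k
          = DE.uact x m (cast (congrArg Bf hxy.symm) (DE.uinner y n k))) ∧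
      -- the norm bound ‖Φ(ξ, k)‖ ≤ ‖ξ‖·‖k‖
      (∀ ξ k, ‖Φ ξ k‖ ≤ ‖ξ‖ * ‖k‖) := by
  obtain ⟨F, hF, hn⟩ := K.R.exists_clm
  refine ⟨fun ξ k => F ξ k, ?_, ?_, ?_, ?_, ?_, ?_, ?_⟩
  · intro ξ ξ' k; simp
  · intro c ξ k; simp
  · intro ξ k k'; simp
  · intro c ξ k; simp
  · fun_prop
  · intro m n k
    beta_reduce
    rw [hF]
    rfl
  · intro ξ k
    exact ((F ξ).le_opNorm k).trans (mul_le_mul_of_nonneg_right (hn ξ) (norm_nonneg _))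
end
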